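/- arXiv:1610.02157 — 4 statements merged into one kernel-verified Lean document; each statement's English description precedes it below -/
import Mathlib

section
/- Let W be a finite-dimensional real vector space, Λ a discrete subgroup of W of rank k, B = B(x_0, r_0) ⊂ ℝ^s a ball, B̃ = B(x_0, 3^k r_0), and H : B̃ → GL(W) a continuous map. Let C ≥ 1, α > 0, 0 < ρ < 1 and let ν be a submultiplicative function on ⋀(W). Assume that for every nonzero primitive subgroup Γ of Λ: (i) the function x ↦ ν(H(x)Γ) is (C, α)-good on B̃; (ii) sup_{x∈B} ν(H(x)Γ) ≥ ρ; and (iii) for every x ∈ B̃ the set {Γ nonzero primitive subgroup of Λ : ν(H(x)Γ) < ρ} is finite. Then for every ε'' > 0, |{x ∈ B : ν(H(x)λ) < ε'' for some λ ∈ Λ∖{0}}| ≤ k (3^s N_s)^k C (ε''/ρ)^α |B|, where N_s is the Besicovitch covering constant of ℝ^s. -/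
open MeasureTheory Metric Set
open scoped BigOperators ENNReal

noncomputable section

/-- `x̃ = (1, x)` -/
def tilde {s : ℕ} (x : Fin s → ℝ) : Fin (s + 1) → ℝ := Fin.cons 1 x

/-- The parametrization `x ↦ (x, x̃A)` of the affine subspace. -/
def phiA {s m : ℕ} (A : Matrix (Fin (s + 1)) (Fin m) ℝ) (x : Fin s → ℝ) :
    Fin (s + m) → ℝ :=
  Fin.append x (Matrix.vecMul (tilde x) A)

/-- `(x, x̃A) · q + p`. -/
def dotA {s m : ℕ} (A : Matrix (Fin (s + 1)) (Fin m) ℝ) (x : Fin s → ℝ)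
    (q : Fin (s + m) → ℤ) : ℝ :=
  ∑ j, phiA A x j * (q j : ℝ)

/-- The gradient `[Id_s A'] q` of `x ↦ (x, x̃A)·q`. -/
def gradA {s m : ℕ} (A : Matrix (Fin (s + 1)) (Fin m) ℝ) (q : Fin (s + m) → ℤ) :
    Fin s → ℝ :=
  fun i => (q (Fin.castAdd m i) : ℝ) + ∑ j, A i.succ j * (q (Fin.natAdd s j) : ℝ)

/-- Coordinate `⟨e_i ∧ e_J, w⟩` of the map `c` (zero unless `J ⊆ {1,…,n}` and `i ∉ J`). -/
def cMap {n : ℕ} (w : Finset (Fin (n + 1)) → ℝ) (i : Fin (n + 1))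
    (J : Finset (Fin (n + 1))) : ℝ :=
  if (0 : Fin (n + 1)) ∈ J ∨ i ∈ J then 0
  else (-1 : ℝ) ^ (J.filter (· < i)).card * w (insert i J)

/-- The matrix `R_A = (Id_{s+1} | A)`. -/
def RA {s m : ℕ} (A : Matrix (Fin (s + 1)) (Fin m) ℝ) :
    Matrix (Fin (s + 1)) (Fin (s + m + 1)) ℝ :=
  fun a i =>
    if h : (i : ℕ) < s + 1 then (if (i : ℕ) = (a : ℕ) then 1 else 0)
    else A a ⟨(i : ℕ) - (s + 1), by omega⟩

/-- Coordinates of `R_A c(w)`. -/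
def RAc {s m : ℕ} (A : Matrix (Fin (s + 1)) (Fin m) ℝ)
    (w : Finset (Fin (s + m + 1)) → ℝ) (a : Fin (s + 1)) (J : Finset (Fin (s + m + 1))) : ℝ :=
  ∑ i, RA A a i * cMap w i J

/-- Euclidean norm of `R_A c(w)`. -/
def RAcNorm {s m : ℕ} (A : Matrix (Fin (s + 1)) (Fin m) ℝ)
    (w : Finset (Fin (s + m + 1)) → ℝ) : ℝ :=
  Real.sqrt (∑ a, ∑ J, (RAc A w a J) ^ 2)

/-- Euclidean norm of the projection `π_•(w)` onto `⋀(W_{s+1→n})`. -/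
def pibullNorm (s : ℕ) {n : ℕ} (w : Finset (Fin (n + 1)) → ℝ) : ℝ :=
  Real.sqrt (∑ S : Finset (Fin (n + 1)),
    if ∀ i ∈ S, s < (i : ℕ) then (w S) ^ 2 else 0)

/-- Euclidean norm of an exterior vector in coordinates. -/
def extNorm {N : ℕ} (w : Finset (Fin N) → ℝ) : ℝ :=
  Real.sqrt (∑ S : Finset (Fin N), (w S) ^ 2)

/-- Euclidean norm of the projection `π(w)` onto `⋀(W_{1→n})`. -/
def piNorm {n : ℕ} (w : Finset (Fin (n + 1)) → ℝ) : ℝ :=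
  Real.sqrt (∑ S : Finset (Fin (n + 1)),
    if (0 : Fin (n + 1)) ∉ S then (w S) ^ 2 else 0)

/-- `w` has pure degree `k`. -/
def ExtDeg {N : ℕ} (k : ℕ) (w : Finset (Fin N) → ℝ) : Prop :=
  ∀ S, S.card ≠ k → w S = 0

/-- The set of exponents `v` appearing in the definition of `ω_j(A)`. -/
def expSet (s m : ℕ) (A : Matrix (Fin (s + 1)) (Fin m) ℝ) (j : ℕ) : Set ℝ :=
  {v | 0 < v ∧ ∀ M : ℝ, ∃ w : Finset (Fin (s + m + 1)) → ℤ,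
    (∀ S, S.card ≠ j → w S = 0) ∧
    M < pibullNorm s (fun S => (w S : ℝ)) ∧
    RAcNorm A (fun S => (w S : ℝ)) <
      pibullNorm s (fun S => (w S : ℝ)) ^ (-(v + 1 - j) / j)}

/-- `ω_j(A) < n` for all `j = 1, …, n − s`  (here `n = s + m`). -/
def DiophCond (s m : ℕ) (A : Matrix (Fin (s + 1)) (Fin m) ℝ) : Prop :=
  ∀ j : ℕ, 1 ≤ j → j ≤ m → ∃ v : ℝ, v < (s + m : ℕ) ∧ ∀ u ∈ expSet s m A j, u ≤ v

/-- Action of a matrix on exterior coordinates (compound matrix action). -/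
def extAction {N : ℕ} (M : Matrix (Fin N) (Fin N) ℝ) (w : Finset (Fin N) → ℝ) :
    Finset (Fin N) → ℝ :=
  fun S => ∑ T : Finset (Fin N),
    if h : T.card = S.card then
      (Matrix.of fun a b : Fin S.card =>
          M (S.orderEmbOfFin rfl a) (T.orderEmbOfFin h b)).det * w T
    else 0

/-- The wedge `v_1 ∧ ⋯ ∧ v_k` of vectors, in coordinates. -/
def wedgeOf {N k : ℕ} (v : Fin k → (Fin N → ℝ)) : Finset (Fin N) → ℝ :=
  fun S =>
    if h : S.card = k then
      (Matrix.of fun a b : Fin k => v a (S.orderEmbOfFin h b)).det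
    else 0

/-- Sign for the wedge product of basis monomials. -/
def wedgeSign {N : ℕ} (T T' : Finset (Fin N)) : ℝ :=
  (-1) ^ (∑ a ∈ T, (T'.filter (· < a)).card)

/-- The wedge (exterior) product in coordinates. -/
def wedgeMul {N : ℕ} (u w : Finset (Fin N) → ℝ) : Finset (Fin N) → ℝ :=
  fun S => ∑ T ∈ S.powerset, wedgeSign T (S \ T) * u T * w (S \ T)

/-- The unipotent matrix `u_x` on `ℝ^{1+s+n}`, `n = s+m`, with block rows
`(1, 0, x, x̃A)`, `(0, I_s, I_s, A')`, `(0, 0, I_n)`. -/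
def uMat {s m : ℕ} (A : Matrix (Fin (s + 1)) (Fin m) ℝ) (x : Fin s → ℝ) :
    Matrix (Fin (1 + s + (s + m))) (Fin (1 + s + (s + m))) ℝ :=
  fun i j =>
    if (i : ℕ) = 0 then
      if (j : ℕ) = 0 then 1
      else if h1 : (j : ℕ) < 1 + s then 0
      else if h2 : (j : ℕ) < 1 + s + s then x ⟨(j : ℕ) - (1 + s), by omega⟩
      else ∑ a, tilde x a * A a ⟨(j : ℕ) - (1 + s + s), by have := j.isLt; omega⟩
    else if hi : (i : ℕ) < 1 + s then
      if (j : ℕ) = 0 then 0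
      else if h1 : (j : ℕ) < 1 + s then (if (j : ℕ) = (i : ℕ) then 1 else 0)
      else if h2 : (j : ℕ) < 1 + s + s then (if (j : ℕ) = (i : ℕ) + s then 1 else 0)
      else A ⟨(i : ℕ), by omega⟩ ⟨(j : ℕ) - (1 + s + s), by have := j.isLt; omega⟩
    else if j = i then 1 else 0

/-- The diagonal matrix `g_t = diag(ε/δ, ε/K, …, ε/K, ε/T, …, ε/T)` on `ℝ^{1+s+n}`. -/
def gMat (s m : ℕ) (δ K T ε : ℝ) :
    Matrix (Fin (1 + s + (s + m))) (Fin (1 + s + (s + m))) ℝ :=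
  Matrix.diagonal fun i =>
    if (i : ℕ) = 0 then ε / δ else if (i : ℕ) < 1 + s then ε / K else ε / T

/-- The vector `(p, 0, …, 0, q) ∈ Λ ⊂ ℤ^{1+s+n}`. -/
def lamVec (s m : ℕ) (p : ℤ) (q : Fin (s + m) → ℤ) : Fin (1 + s + (s + m)) → ℝ :=
  fun i =>
    if (i : ℕ) = 0 then (p : ℝ)
    else if h : (i : ℕ) < 1 + s then 0
    else (q ⟨(i : ℕ) - (1 + s), by have := i.isLt; omega⟩ : ℝ)

/-- The matrix `ũ_x` on `ℝ^{n+1}`, with block rows `(1, x, x̃A)` and `(0, I_n)`. -/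
def utMat {s m : ℕ} (A : Matrix (Fin (s + 1)) (Fin m) ℝ) (x : Fin s → ℝ) :
    Matrix (Fin (s + m + 1)) (Fin (s + m + 1)) ℝ :=
  fun i j =>
    if (i : ℕ) = 0 then
      if h : (j : ℕ) = 0 then 1
      else phiA A x ⟨(j : ℕ) - 1, by have := j.isLt; omega⟩
    else if j = i then 1 else 0

/-- The diagonal matrix `g̃_t = diag(ε/δ, ε/T, …, ε/T)` on `ℝ^{n+1}`. -/
def gtMat (s m : ℕ) (δ T ε : ℝ) : Matrix (Fin (s + m + 1)) (Fin (s + m + 1)) ℝ :=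
  Matrix.diagonal fun i => if (i : ℕ) = 0 then ε / δ else ε / T

/-- The function `ν(w) = ‖π_*(w)‖`: the euclidean norm of the part of `w` involving at most
one of the starred basis vectors `e_{*1}, …, e_{*s}` (indices `1, …, s` of `ℝ^{1+s+n}`). -/
def nuFun (s m : ℕ) (w : Finset (Fin (1 + s + (s + m))) → ℝ) : ℝ :=
  Real.sqrt (∑ S : Finset (Fin (1 + s + (s + m))),
    if (S.filter fun i : Fin (1 + s + (s + m)) => 1 ≤ (i : ℕ) ∧ (i : ℕ) < 1 + s).card ≤ 1
    then (w S) ^ 2 else 0)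

/-- `δ := κ/2^{nt}`. -/
def deltaP (s m : ℕ) (κ : ℝ) (t : ℕ) : ℝ := κ / 2 ^ ((s + m) * t)

/-- `K := √(ns/(2r²))·2^{t/2}`. -/
def KofT (s m : ℕ) (r : ℝ) (t : ℕ) : ℝ :=
  Real.sqrt (((s + m : ℕ) : ℝ) * s / (2 * r ^ 2)) * 2 ^ ((t : ℝ) / 2)

/-- `T := 2^{t+1}`. -/
def TofT (t : ℕ) : ℝ := 2 ^ (t + 1)

/-- `ε' := (δKT^{n−1})^{1/(n+1)}`. -/
def epsP' (s m : ℕ) (κ r : ℝ) (t : ℕ) : ℝ :=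
  (deltaP s m κ t * KofT s m r t * TofT t ^ (s + m - 1)) ^ (1 / ((s + m : ℕ) + 1 : ℝ))

/-- `ε := 2^{βt} ε'`. -/
def epsP (s m : ℕ) (κ r β : ℝ) (t : ℕ) : ℝ :=
  (2 : ℝ) ^ (β * t) * epsP' s m κ r t

/-- `‖ỹ c(w)‖` where `ỹ = (1, x, x̃A) = x̃ R_A`. -/
def ycNorm {s m : ℕ} (A : Matrix (Fin (s + 1)) (Fin m) ℝ) (x : Fin s → ℝ)
    (w : Finset (Fin (s + m + 1)) → ℝ) : ℝ :=
  Real.sqrt (∑ J : Finset (Fin (s + m + 1)),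
    (∑ i, (Fin.cons (1 : ℝ) (phiA A x) : Fin (s + m + 1) → ℝ) i * cMap w i J) ^ 2)

/-- A function is `(C, α)`-good on `V ⊆ ℝ^s`. -/
def IsGood (s : ℕ) (C α : ℝ) (f : EuclideanSpace ℝ (Fin s) → ℝ)
    (V : Set (EuclideanSpace ℝ (Fin s))) : Prop :=
  ∀ (y₀ : EuclideanSpace ℝ (Fin s)) (r : ℝ), 0 < r → ball y₀ r ⊆ V →
    ∀ ε : ℝ, 0 < ε →
      volume {x ∈ ball y₀ r | |f x| < ε} ≤
        ENNReal.ofReal (C * (ε / sSup ((fun y => |f y|) '' ball y₀ r)) ^ α) *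
          volume (ball y₀ r)

/-- `V_s`: the volume of the `s`-dimensional euclidean unit ball. -/
def Vball (s : ℕ) : ℝ := (volume (ball (0 : EuclideanSpace ℝ (Fin s)) 1)).toReal

/-- `N_s`: the Besicovitch covering constant of `ℝ^s`. -/
def Nbes (s : ℕ) : ℕ := Besicovitch.multiplicity (EuclideanSpace ℝ (Fin s))

/-- `K_s := 4^{2s+1} s^{s/2} N_s / V_s`. -/
def Kcst (s : ℕ) : ℝ :=
  4 ^ (2 * s + 1) * (s : ℝ) ^ ((s : ℝ) / 2) * (Nbes s : ℝ) / Vball s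

/-- `Γ` is a primitive subgroup of `Λ`: `Γ ≤ Λ` and `Γ_ℝ ∩ Λ = Γ`. -/
def IsPrimitiveIn {d : ℕ} (Λ Γ : Submodule ℤ (Fin d → ℝ)) : Prop :=
  Γ ≤ Λ ∧
    (Submodule.span ℝ (Γ : Set (Fin d → ℝ))).restrictScalars ℤ ⊓ Λ = Γ

/-- `u` is a basis of the discrete subgroup `Γ` (so `u₁ ∧ ⋯ ∧ u_j` represents `Γ`). -/
def Represents {d j : ℕ} (u : Fin j → (Fin d → ℝ)) (Γ : Submodule ℤ (Fin d → ℝ)) : Prop :=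
  LinearIndependent ℝ u ∧ Submodule.span ℤ (Set.range u) = Γ

/-- `w = v₁ ∧ ⋯ ∧ v_k` represents the nonzero primitive rank-`k` subgroup of `ℤ^N`
generated by `v₁, …, v_k`. -/
def RepresentsPrimInt {N k : ℕ} (v : Fin k → (Fin N → ℤ)) (w : Finset (Fin N) → ℝ) : Prop :=
  LinearIndependent ℝ (fun a => fun i => ((v a i : ℝ))) ∧
  (∀ z : Fin N → ℤ,
      ((fun i => (z i : ℝ)) ∈
        Submodule.span ℝ (Set.range fun a => fun i => ((v a i : ℝ)))) →
      z ∈ Submodule.span ℤ (Set.range v)) ∧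
  w = wedgeOf fun a => fun i => ((v a i : ℝ))
/-- The family of balls extracted by the Besicovitch covering theorem bounds the volume of a set
that is small on every ball of the original family. -/
theorem volume_le_of_forall_ball_le {s : ℕ} [Nontrivial (EuclideanSpace ℝ (Fin s))]
    (A E U : Set (EuclideanSpace ℝ (Fin s))) (hAE : A ⊆ E)
    (r : EuclideanSpace ℝ (Fin s) → ℝ) (R : ℝ)
    (hr : ∀ x ∈ E, 0 < r x) (hrR : ∀ x ∈ E, r x ≤ R) (hU : ∀ x ∈ E, ball x (r x) ⊆ U)
    (c : ℝ≥0∞)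
    (hA : ∀ x ∈ E, volume (A ∩ ball x (r x)) ≤ c * volume (ball x (r x))) :
    volume A ≤ Nbes s * (c * volume U) := by
  let q : Besicovitch.BallPackage E (EuclideanSpace ℝ (Fin s)) :=
    { c := fun x => x
      r := fun x => r x
      rpos := fun x => hr x x.2
      r_bound := R
      r_le := fun x => hrR x x.2 }
  obtain ⟨t, hdisj, hcov⟩ := Besicovitch.exist_disjoint_covering_families
    (Besicovitch.one_lt_goodτ (EuclideanSpace ℝ (Fin s)))
    (Besicovitch.isEmpty_satelliteConfig_multiplicity (EuclideanSpace ℝ (Fin s))) q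
  have hdisj' : ∀ i, (t i).PairwiseDisjoint fun j => ball (q.c j) (q.r j) := fun i =>
    (hdisj i).mono fun _ => ball_subset_closedBall
  have hcount : ∀ i, (t i).Countable := fun i =>
    (hdisj' i).countable_of_isOpen (fun _ _ => isOpen_ball)
      fun j _ => nonempty_ball.2 (q.rpos j)
  have hAcov : A ⊆ ⋃ i, ⋃ j ∈ t i, A ∩ ball (q.c j) (q.r j) := by
    intro x hx
    have := hcov ⟨⟨x, hAE hx⟩, rfl⟩
    simp only [mem_iUnion, mem_inter_iff] at this ⊢
    obtain ⟨i, j, hj, h⟩ := this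
    exact ⟨i, j, hj, hx, h⟩
  have hfam : ∀ i, volume (⋃ j ∈ t i, A ∩ ball (q.c j) (q.r j)) ≤ c * volume U := by
    intro i
    have := (hcount i).to_subtype
    calc volume (⋃ j ∈ t i, A ∩ ball (q.c j) (q.r j))
        ≤ ∑' j : t i, volume (A ∩ ball (q.c j) (q.r j)) := measure_biUnion_le _ (hcount i) _
      _ ≤ ∑' j : t i, c * volume (ball (q.c j) (q.r j)) :=
          ENNReal.tsum_le_tsum fun j => hA _ j.1.2
      _ = c * volume (⋃ j ∈ t i, ball (q.c j) (q.r j)) := by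
          rw [ENNReal.tsum_mul_left, measure_biUnion (hcount i) (hdisj' i)
            fun _ _ => measurableSet_ball]
      _ ≤ c * volume U := by
          gcongr
          exact iUnion₂_subset fun j _ => hU _ j.2
  calc volume A ≤ volume (⋃ i, ⋃ j ∈ t i, A ∩ ball (q.c j) (q.r j)) := measure_mono hAcov
    _ ≤ ∑ i, volume (⋃ j ∈ t i, A ∩ ball (q.c j) (q.r j)) := measure_iUnion_fintype_le _ _
    _ ≤ ∑ _i : Fin (Besicovitch.multiplicity (EuclideanSpace ℝ (Fin s))), c * volume U :=
        Finset.sum_le_sum fun i _ => hfam i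
    _ = Nbes s * (c * volume U) := by simp [Nbes]

/-- The defining inequality of a good function, with the supremum replaced by a lower bound. -/
theorem IsGood.volume_le {s : ℕ} {C α : ℝ} {f : EuclideanSpace ℝ (Fin s) → ℝ}
    {V : Set (EuclideanSpace ℝ (Fin s))} (hf : IsGood s C α f V) (hf0 : ∀ x, 0 ≤ f x)
    (hC : 0 ≤ C) (hα : 0 < α)
    {y : EuclideanSpace ℝ (Fin s)} {r : ℝ} (hr : 0 < r) (hV : ball y r ⊆ V)
    {ρ ε : ℝ} (hρ : 0 < ρ) (hε : 0 < ε)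
    (hsup : ∀ η < ρ, ∃ x ∈ ball y r, η < f x) :
    volume {x ∈ ball y r | f x < ε} ≤ ENNReal.ofReal (C * (ε / ρ) ^ α) * volume (ball y r) := by
  have h := hf y r hr hV ε hε
  simp only [abs_of_nonneg (hf0 _)] at h
  refine h.trans ?_
  gcongr ENNReal.ofReal (C * ?_) * _
  by_cases hb : BddAbove (f '' ball y r)
  · have : ρ ≤ sSup (f '' ball y r) := by
      refine le_of_forall_lt fun η hη => ?_
      obtain ⟨x, hx, hlt⟩ := hsup η hη
      exact hlt.trans_le (le_csSup hb ⟨x, hx, rfl⟩)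
    exact Real.rpow_le_rpow (div_nonneg hε.le (hρ.le.trans this)) (by gcongr) hα.le
  · rw [Real.sSup_of_not_bddAbove hb, div_zero, Real.zero_rpow hα.ne']
    positivity

/-- A point is marked if some finite flag of `S` has all its values in `[ε, ρ)` while every
element comparable with the flag has value at least `ρ`. -/
def IsMarked {P : Type*} [PartialOrder P] (S : Set P) (ρ ε : ℝ) (g : P → ℝ) : Prop :=
  ∃ F : Finset P, ↑F ⊆ S ∧ IsChain (· ≤ ·) (F : Set P) ∧ (∀ p ∈ F, ε ≤ g p ∧ g p < ρ) ∧
    ∀ p ∈ S, p ∉ F → (∀ q ∈ F, p ≤ q ∨ q ≤ p) → ρ ≤ g p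

open Classical in
theorem IsMarked.insert {P : Type*} [PartialOrder P] {S : Set P} {ρ ε : ℝ} {g : P → ℝ} {p : P}
    (hp : p ∈ S) (hε : ε ≤ g p) (hρ : g p < ρ)
    (h : IsMarked {q ∈ S | q ≠ p ∧ (q ≤ p ∨ p ≤ q)} ρ ε g) : IsMarked S ρ ε g := by
  obtain ⟨F, hFS, hF, hFg, hmax⟩ := h
  refine ⟨Insert.insert p F, ?_, ?_, ?_, ?_⟩
  · rw [Finset.coe_insert, insert_subset_iff]
    exact ⟨hp, fun q hq => (hFS hq).1⟩
  · rw [Finset.coe_insert]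
    exact hF.insert fun q hq _ => (hFS hq).2.2.symm
  · simpa using ⟨⟨hε, hρ⟩, hFg⟩
  · intro q hq hqF hcomp
    rw [Finset.mem_insert, not_or] at hqF
    exact hmax q ⟨hq, hqF.1, hcomp p (Finset.mem_insert_self _ _)⟩ hqF.2
      fun t ht => hcomp t (Finset.mem_insert_of_mem ht)

/-- If `f` reaches the level `ρ` on `closedBall x R`, there is a smallest closed ball around `x`
on which it does. -/
theorem exists_smallest_radius {X : Type*} [MetricSpace X] [ProperSpace X] {f : X → ℝ}
    {x : X} {R ρ : ℝ} (hf : ContinuousOn f (closedBall x R)) (h : ∃ y ∈ closedBall x R, ρ ≤ f y) :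
    ∃ r ≤ R, (∃ y ∈ closedBall x r, ρ ≤ f y) ∧ (∀ y ∈ ball x r, f y < ρ) ∧
      (f x < ρ → 0 < r) := by
  have hK : IsCompact (closedBall x R ∩ f ⁻¹' Ici ρ) :=
    (isCompact_closedBall x R).of_isClosed_subset
      (hf.preimage_isClosed_of_isClosed isClosed_closedBall isClosed_Ici) inter_subset_left
  obtain ⟨y, ⟨hyR, hyρ⟩, hmin⟩ := hK.exists_isMinOn h
    (Continuous.continuousOn (f := fun y => dist y x) (by fun_prop))
  refine ⟨dist y x, hyR, ⟨y, mem_closedBall.2 le_rfl, hyρ⟩, fun z hz => ?_, fun hx => ?_⟩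
  · by_contra! hzρ
    have : dist y x ≤ dist z x := hmin ⟨(mem_ball.1 hz).le.trans hyR, hzρ⟩
    exact this.not_gt hz
  · refine dist_pos.2 fun h0 => ?_
    rw [h0] at hyρ
    exact hx.not_ge hyρ

theorem one_le_three_pow_mul_Nbes (s : ℕ) : (1 : ℝ) ≤ (3 : ℝ) ^ s * (Nbes s : ℝ) := by
  refine one_le_mul_of_one_le_of_one_le (one_le_pow₀ (by norm_num)) ?_
  exact_mod_cast Besicovitch.card_le_multiplicity (s := {(0 : EuclideanSpace ℝ (Fin s))})
    (by simp) (by simp)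

/-- The measure bound for points without a marking flag, by induction on the length of the
poset `S`. -/
theorem volume_not_isMarked_le {P : Type*} [PartialOrder P] {s : ℕ} (hs : 1 ≤ s)
    {C α ρ ε : ℝ} (hC : 0 ≤ C) (hα : 0 < α) (hρ : 0 < ρ) (hε : 0 < ε)
    (f : P → EuclideanSpace ℝ (Fin s) → ℝ) (hf0 : ∀ p x, 0 ≤ f p x) (k : ℕ) :
    ∀ (S : Set P) (x₀ : EuclideanSpace ℝ (Fin s)) (r₀ : ℝ), 0 < r₀ →
      (∀ F : Finset P, ↑F ⊆ S → IsChain (· ≤ ·) (F : Set P) → F.card ≤ k) →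
      (∀ p ∈ S, ContinuousOn (f p) (ball x₀ (3 ^ k * r₀))) →
      (∀ p ∈ S, IsGood s C α (f p) (ball x₀ (3 ^ k * r₀))) →
      (∀ p ∈ S, ∀ η < ρ, ∃ x ∈ ball x₀ r₀, η < f p x) →
      (∀ x ∈ ball x₀ (3 ^ k * r₀), {p ∈ S | f p x < ρ}.Finite) →
      volume {x ∈ ball x₀ r₀ | ¬ IsMarked S ρ ε fun p => f p x} ≤
        ENNReal.ofReal ((k : ℝ) * ((3 : ℝ) ^ s * (Nbes s : ℝ)) ^ k * C * (ε / ρ) ^ α) *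
          volume (ball x₀ r₀) := by
  have : Nontrivial (EuclideanSpace ℝ (Fin s)) := by
    have : Nonempty (Fin s) := ⟨⟨0, hs⟩⟩
    infer_instance
  have hN := one_le_three_pow_mul_Nbes s
  induction k with
  | zero =>
    intro S x₀ r₀ hr₀ hlen _ _ _ _
    have hS : ∀ p, p ∉ S := fun p hp => by
      simpa using hlen {p} (by simpa using hp) (by simp [IsChain])
    have hM : ∀ x, IsMarked S ρ ε fun p => f p x := fun x =>
      ⟨∅, by simp, by simp [IsChain], by simp, fun p hp => absurd hp (hS p)⟩
    simp [hM]
  | succ k ih =>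
    intro S x₀ r₀ hr₀ hlen hcont hgood hsup hfin
    have h3k : (1 : ℝ) ≤ 3 ^ k := one_le_pow₀ (by norm_num)
    have hbig : 3 * r₀ ≤ 3 ^ (k + 1) * r₀ := by
      rw [pow_succ]; nlinarith
    -- a radius and an element of `S` attached to each point where some `f p` is small
    have hsel : ∀ x ∈ ball x₀ r₀, (∃ p ∈ S, f p x < ρ) → ∃ r : ℝ, ∃ p ∈ S, 0 < r ∧
        r ≤ r₀ + dist x x₀ ∧ (∀ y ∈ ball x r, f p y < ρ) ∧
        ∀ q ∈ S, ∃ y ∈ closedBall x r, ρ ≤ f q y := by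
      intro x hx hex
      have hx' : dist x x₀ < r₀ := hx
      have hsub : closedBall x (r₀ + dist x x₀) ⊆ ball x₀ (3 ^ (k + 1) * r₀) :=
        (closedBall_subset_ball' (by linarith)).trans (ball_subset_ball hbig)
      have hlevel : ∀ p ∈ S, ∃ y ∈ closedBall x (r₀ + dist x x₀), ρ ≤ f p y := by
        intro p hp
        have hsub' : closedBall x₀ r₀ ⊆ closedBall x (r₀ + dist x x₀) :=
          closedBall_subset_closedBall' (by rw [dist_comm])
        obtain ⟨y, hy, hmax⟩ := (isCompact_closedBall x₀ r₀).exists_isMaxOn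
          ⟨x₀, mem_closedBall_self hr₀.le⟩ ((hcont p hp).mono (hsub'.trans hsub))
        refine ⟨y, hsub' hy, le_of_forall_lt fun η hη => ?_⟩
        obtain ⟨z, hz, hlt⟩ := hsup p hp η hη
        exact hlt.trans_le (hmax (ball_subset_closedBall hz))
      have hrad : ∀ p : S, ∃ r ≤ r₀ + dist x x₀, (∃ y ∈ closedBall x r, ρ ≤ f p y) ∧
          (∀ y ∈ ball x r, f p y < ρ) ∧ (f p x < ρ → 0 < r) := fun p =>
        exists_smallest_radius ((hcont p p.2).mono hsub) (hlevel p p.2)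
      choose r hrle hrex hrlt hrpos using hrad
      have hfinx : {p : S | f p x < ρ}.Finite := by
        refine Set.Finite.of_finite_image ((hfin x (hsub (mem_closedBall_self
          (by positivity)))).subset ?_) Subtype.val_injective.injOn
        rintro _ ⟨p, hp, rfl⟩
        exact ⟨p.2, hp⟩
      obtain ⟨p₀, hp₀S, hp₀⟩ := hex
      obtain ⟨p, hp, hmax⟩ := Set.exists_max_image _ r hfinx ⟨⟨p₀, hp₀S⟩, hp₀⟩
      refine ⟨r p, p, p.2, hrpos p hp, hrle p, hrlt p, fun q hq => ?_⟩
      by_cases hqx : f q x < ρ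
      · obtain ⟨y, hy, h⟩ := hrex ⟨q, hq⟩
        exact ⟨y, closedBall_subset_closedBall (hmax ⟨q, hq⟩ hqx) hy, h⟩
      · exact ⟨x, mem_closedBall_self (hrpos p hp).le, not_lt.1 hqx⟩
    set E : Set (EuclideanSpace ℝ (Fin s)) := {x ∈ ball x₀ r₀ | ∃ p ∈ S, f p x < ρ}
    set A := {x ∈ ball x₀ r₀ | ¬ IsMarked S ρ ε fun p => f p x}
    have hAE : A ⊆ E := by
      rintro x ⟨hx, hM⟩
      refine ⟨hx, ?_⟩
      by_contra! h
      exact hM ⟨∅, by simp, by simp [IsChain], by simp, fun p hp _ _ => h p hp⟩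
    cases isEmpty_or_nonempty P with
    | inl hP =>
      have hA : A = ∅ := subset_empty_iff.1 fun x hx => isEmptyElim (hAE hx).2.choose
      simp [hA]
    | inr hP =>
      choose! r p hpS hr0 hrle hrlt hrlevel using hsel
      set D : ℝ := (3 : ℝ) ^ s * (Nbes s : ℝ) with hD
      have hball : ∀ x ∈ E, volume (A ∩ ball x (r x)) ≤
          ENNReal.ofReal ((k + 1) * D ^ k * C * (ε / ρ) ^ α) * volume (ball x (r x)) := by
        rintro x ⟨hx, hex⟩
        have hx' : dist x x₀ < r₀ := hx
        have hr0x := hr0 x hx hex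
        have hrx := hrle x hx hex
        have hsub : ball x (3 ^ k * r x) ⊆ ball x₀ (3 ^ (k + 1) * r₀) := by
          refine ball_subset_ball' ?_
          rw [pow_succ]
          nlinarith
        have hsub1 : ball x (r x) ⊆ ball x (3 ^ k * r x) :=
          ball_subset_ball (by nlinarith)
        have hcl : closedBall x (r x) ⊆ ball x₀ (3 ^ (k + 1) * r₀) :=
          (closedBall_subset_ball' (by linarith)).trans (ball_subset_ball hbig)
        have hsup' : ∀ q ∈ S, ∀ η < ρ, ∃ y ∈ ball x (r x), η < f q y := by
          intro q hq η hη
          obtain ⟨y, hy, hyρ⟩ := hrlevel x hx hex q hq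
          by_contra! hle
          have : f q y ≤ η := by
            rw [← closure_ball x hr0x.ne'] at hy hcl
            exact closure_minimal (t := Iic η) (image_subset_iff.2 fun z hz => hle z hz) isClosed_Iic
              (((hcont q hq).mono hcl).image_closure ⟨y, hy, rfl⟩)
          linarith
        let S' := {q ∈ S | q ≠ p x ∧ (q ≤ p x ∨ p x ≤ q)}
        have hind := ih S' x (r x) hr0x ?_ (fun q hq => (hcont q hq.1).mono hsub) ?_
          (fun q hq => hsup' q hq.1) ?_
        · have hg := (hgood (p x) (hpS x hx hex)).volume_le (hf0 _) hC hα hr0x (hsub1.trans hsub)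
            hρ hε (hsup' _ (hpS x hx hex))
          have hcover : A ∩ ball x (r x) ⊆ {y ∈ ball x (r x) | ¬ IsMarked S' ρ ε fun q => f q y} ∪
              {y ∈ ball x (r x) | f (p x) y < ε} := by
            rintro y ⟨⟨_, hyM⟩, hy⟩
            by_contra h
            simp only [mem_union, mem_ofPred_eq, not_or, not_and, not_not, not_lt] at h
            exact hyM (IsMarked.insert (hpS x hx hex) (h.2 hy) (hrlt x hx hex y hy) (h.1 hy))
          refine (measure_mono hcover).trans ((measure_union_le _ _).trans
            ((add_le_add hind hg).trans ?_))
          rw [← add_mul, ← ENNReal.ofReal_add (by positivity) (by positivity)]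
          gcongr ENNReal.ofReal ?_ * _
          have h1 : 1 ≤ D ^ k := one_le_pow₀ hN
          have h2 : 0 ≤ C * (ε / ρ) ^ α := by positivity
          nlinarith
        · intro F hF hFc
          classical
          have hnot : p x ∉ F := fun h => (hF h).2.1 rfl
          have := hlen (Insert.insert (p x) F) ?_ ?_
          · rw [Finset.card_insert_of_notMem hnot] at this
            omega
          · rw [Finset.coe_insert, insert_subset_iff]
            exact ⟨hpS x hx hex, fun q hq => (hF hq).1⟩
          · rw [Finset.coe_insert]
            exact hFc.insert fun q hq _ => (hF hq).2.2.symm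
        · intro q hq y t ht hV
          exact hgood q hq.1 y t ht (hV.trans hsub)
        · intro y hy
          exact (hfin y (hsub hy)).subset fun q hq => ⟨hq.1.1, hq.2⟩
      refine (volume_le_of_forall_ball_le A E (ball x₀ (3 * r₀)) hAE r (2 * r₀)
        (fun x hx => hr0 x hx.1 hx.2) ?_ ?_ _ hball).trans ?_
      · rintro x ⟨hx, hex⟩
        have hx' : dist x x₀ < r₀ := hx
        linarith [hrle x hx hex]
      · rintro x ⟨hx, hex⟩
        have hx' : dist x x₀ < r₀ := hx
        exact ball_subset_ball' (by linarith [hrle x hx hex])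
      · rw [Measure.addHaar_ball_mul volume x₀ (by norm_num : (0 : ℝ) ≤ 3) r₀, finrank_euclideanSpace,
          Fintype.card_fin, Measure.addHaar_ball_center volume x₀, ← mul_assoc, ← mul_assoc,
          ← ENNReal.ofReal_natCast, ← ENNReal.ofReal_mul (by positivity),
          ← ENNReal.ofReal_mul (by positivity)]
        refine mul_le_mul_left (ENNReal.ofReal_le_ofReal (le_of_eq ?_)) _
        push_cast
        rw [hD]
        ring

/-- A coordinate of `v₁ ∧ ⋯ ∧ v_k`, as an alternating map. -/
def wedgeCoord {N k : ℕ} (S : Finset (Fin N)) (h : S.card = k) :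
    (Fin N → ℝ) [⋀^Fin k]→ₗ[ℝ] ℝ :=
  Matrix.detRowAlternating.compLinearMap (LinearMap.funLeft ℝ ℝ (S.orderEmbOfFin h))

theorem wedgeCoord_apply {N k : ℕ} (S : Finset (Fin N)) (h : S.card = k)
    (v : Fin k → (Fin N → ℝ)) : wedgeCoord S h v = wedgeOf v S := by
  simp only [wedgeOf, dif_pos h]
  rfl

theorem wedgeOf_eq_zero {N k : ℕ} (v : Fin k → (Fin N → ℝ)) {S : Finset (Fin N)}
    (h : S.card ≠ k) : wedgeOf v S = 0 := dif_neg h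

theorem wedgeOf_matrix_mul {N k : ℕ} (M : Matrix (Fin k) (Fin k) ℝ) (u : Matrix (Fin k) (Fin N) ℝ) :
    wedgeOf (M * u) = M.det • wedgeOf u := by
  ext S
  by_cases h : S.card = k
  · simp only [wedgeOf, dif_pos h, Pi.smul_apply, smul_eq_mul]
    rw [← Matrix.det_mul]
    rfl
  · simp [wedgeOf, h]

/-- A compound-matrix coordinate of a wedge product, as an alternating map. -/
def extActionCoord {N : ℕ} (M : Matrix (Fin N) (Fin N) ℝ) (S : Finset (Fin N)) :
    (Fin N → ℝ) [⋀^Fin S.card]→ₗ[ℝ] ℝ :=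
  ∑ T : Finset (Fin N), if h : T.card = S.card then
    (Matrix.of fun a b : Fin S.card =>
      M (S.orderEmbOfFin rfl a) (T.orderEmbOfFin h b)).det • wedgeCoord T h else 0

theorem extActionCoord_apply {N : ℕ} (M : Matrix (Fin N) (Fin N) ℝ) (S : Finset (Fin N))
    (v : Fin S.card → (Fin N → ℝ)) : extActionCoord M S v = extAction M (wedgeOf v) S := by
  let ev : (Fin N → ℝ) [⋀^Fin S.card]→ₗ[ℝ] ℝ →+ ℝ :=
    { toFun := fun f => f v, map_zero' := rfl, map_add' := fun _ _ => rfl }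
  change ev (extActionCoord M S) = _
  rw [extActionCoord, extAction, map_sum]
  refine Finset.sum_congr rfl fun T _ => ?_
  split_ifs with h
  · rw [← wedgeCoord_apply T h]
    rfl
  · rfl

/-- The compound-matrix action is functorial on decomposable vectors (Cauchy–Binet). -/
theorem extAction_wedgeOf {N k : ℕ} (M : Matrix (Fin N) (Fin N) ℝ) (v : Fin k → (Fin N → ℝ)) :
    extAction M (wedgeOf v) = wedgeOf fun a => M.mulVec (v a) := by
  ext S
  by_cases hS : S.card = k
  swap
  · rw [wedgeOf_eq_zero _ hS, extAction]
    refine Finset.sum_eq_zero fun T _ => ?_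
    split_ifs with h
    · rw [wedgeOf_eq_zero _ (h.trans_ne hS), mul_zero]
    · rfl
  subst hS
  suffices h : extActionCoord M S = (wedgeCoord S rfl).compLinearMap M.mulVecLin by
    rw [← extActionCoord_apply, h, ← wedgeCoord_apply S rfl]
    rfl
  refine (Pi.basisFun ℝ (Fin N)).ext_alternating fun e he => ?_
  have hcard : (Finset.univ.image e).card = S.card := by
    rw [Finset.card_image_of_injective _ he, Finset.card_fin]
  simp only [Pi.basisFun_apply]
  rw [extActionCoord_apply, extAction, Finset.sum_eq_single (Finset.univ.image e)]
  · rw [dif_pos hcard, AlternatingMap.compLinearMap_apply, wedgeCoord_apply, wedgeOf, wedgeOf,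
      dif_pos hcard, dif_pos rfl, ← Matrix.det_transpose (Matrix.of fun a b => (Pi.single (e a) (1 : ℝ) : Fin N → ℝ) _),
      ← Matrix.det_mul, ← Matrix.det_transpose]
    congr 1
    ext b a
    obtain ⟨c, hc⟩ : e b ∈ range ((Finset.univ.image e).orderEmbOfFin hcard) := by
      simp
    simp only [Matrix.transpose_apply, Matrix.mul_apply, Matrix.of_apply, Matrix.mulVecLin_apply,
      Matrix.mulVec_single_one, Matrix.col_apply]
    rw [Finset.sum_eq_single c]
    · simp [hc]
    · intro c' _ hne
      rw [← hc, Pi.single_eq_of_ne (by simpa using hne), mul_zero]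
    · simp
  · intro T _ hT
    split_ifs with h
    · obtain ⟨t, htT, ht⟩ : ∃ t ∈ T, t ∉ Finset.univ.image e := by
        by_contra! hsub
        exact hT (Finset.eq_of_subset_of_card_le hsub (hcard.trans h.symm).le)
      obtain ⟨c, rfl⟩ : t ∈ range (T.orderEmbOfFin h) := by simpa using htT
      have hzero : wedgeOf (fun a => (Pi.single (e a) 1 : Fin N → ℝ)) T = 0 := by
        rw [wedgeOf, dif_pos h]
        refine Matrix.det_eq_zero_of_column_eq_zero c fun a => ?_
        refine Pi.single_eq_of_ne (fun heq => ht ?_) _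
        rw [heq]
        simp
      rw [hzero, mul_zero]
    · rfl
  · simp

theorem extAction_smul {N : ℕ} (M : Matrix (Fin N) (Fin N) ℝ) (c : ℝ) (w : Finset (Fin N) → ℝ) :
    extAction M (c • w) = c • extAction M w := by
  ext S
  simp only [extAction, Pi.smul_apply, smul_eq_mul, Finset.mul_sum]
  refine Finset.sum_congr rfl fun T _ => ?_
  split_ifs
  · ring
  · simp

theorem continuous_extAction {N : ℕ} (w : Finset (Fin N) → ℝ) :
    Continuous fun M : Matrix (Fin N) (Fin N) ℝ => extAction M w := by
  refine continuous_pi fun S => continuous_finsetSum _ fun T _ => ?_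
  split_ifs with h
  · refine Continuous.mul (Continuous.matrix_det ?_) continuous_const
    exact continuous_matrix fun a b => continuous_apply_apply _ _
  · exact continuous_const

theorem orderEmbOfFin_erase {N j : ℕ} {S : Finset (Fin N)} (h : S.card = j + 1) (i : Fin (j + 1))
    (h' : (S \ {S.orderEmbOfFin h i}).card = j) :
    ⇑((S \ {S.orderEmbOfFin h i}).orderEmbOfFin h') = S.orderEmbOfFin h ∘ i.succAbove := by
  refine (Finset.orderEmbOfFin_unique h' (fun x => ?_)
    ((S.orderEmbOfFin h).strictMono.comp (Fin.strictMono_succAbove i))).symm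
  simp [Finset.orderEmbOfFin_mem]

theorem card_filter_lt_orderEmbOfFin {N j : ℕ} {S : Finset (Fin N)} (h : S.card = j)
    (i : Fin j) : (S.filter (· < S.orderEmbOfFin h i)).card = i := by
  have : S.filter (· < S.orderEmbOfFin h i) = (Finset.Iio i).map (S.orderEmbOfFin h).toEmbedding := by
    ext x
    simp only [Finset.mem_filter, Finset.mem_map, Finset.mem_Iio]
    constructor
    · rintro ⟨hx, hlt⟩
      obtain ⟨c, rfl⟩ : x ∈ range (S.orderEmbOfFin h) := by simpa using hx
      exact ⟨c, by simpa using hlt, rfl⟩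
    · rintro ⟨c, hc, rfl⟩
      exact ⟨by simp [Finset.orderEmbOfFin_mem], by simpa using hc⟩
  rw [this, Finset.card_map, Fin.card_Iio]

/-- Wedging a vector with a decomposable vector is Laplace expansion along the first row. -/
theorem wedgeMul_wedgeOf_cons {N j : ℕ} (x : Fin N → ℝ) (u : Fin j → (Fin N → ℝ)) :
    wedgeMul (wedgeOf fun _ : Fin 1 => x) (wedgeOf u) =
      wedgeOf (Fin.cons x u : Fin (j + 1) → (Fin N → ℝ)) := by
  ext S
  have hsum : wedgeMul (wedgeOf fun _ : Fin 1 => x) (wedgeOf u) S =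
      ∑ i ∈ S, wedgeSign {i} (S \ {i}) * x i * wedgeOf u (S \ {i}) := by
    rw [wedgeMul]
    refine (Finset.sum_of_injOn (fun i => ({i} : Finset (Fin N)))
      (Finset.singleton_injective.injOn) ?_ ?_ ?_).symm
    · intro i hi
      simpa using hi
    · intro T _ hT
      rw [wedgeOf_eq_zero, mul_zero, zero_mul]
      intro hT1
      obtain ⟨i, rfl⟩ := Finset.card_eq_one.1 hT1
      exact hT ⟨i, by simp_all, rfl⟩
    · intro i _
      have : wedgeOf (fun _ : Fin 1 => x) {i} = x i := by
        simp [wedgeOf]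
      rw [this]
  rw [hsum]
  by_cases h : S.card = j + 1
  · rw [wedgeOf, dif_pos h, Matrix.det_succ_row_zero]
    refine (Finset.sum_of_injOn (S.orderEmbOfFin h) (S.orderEmbOfFin h).injective.injOn
      (fun i _ => by simp [Finset.orderEmbOfFin_mem]) ?_ fun i _ => ?_).symm
    · intro i hi hi'
      exact absurd (by simpa using hi) hi'
    · have h' : (S \ {S.orderEmbOfFin h i}).card = j := by
        rw [Finset.card_sdiff_of_subset (by simp [Finset.orderEmbOfFin_mem]), h]
        simp
      have hs : ((S \ {S.orderEmbOfFin h i}).filter (· < S.orderEmbOfFin h i)).card = i := by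
        rw [← card_filter_lt_orderEmbOfFin h i]
        congr 1
        ext c
        simp only [Finset.mem_filter, Finset.mem_sdiff, Finset.mem_singleton]
        exact ⟨fun hc => ⟨hc.1.1, hc.2⟩, fun hc => ⟨⟨hc.1, hc.2.ne⟩, hc.2⟩⟩
      rw [wedgeSign, Finset.sum_singleton, hs, wedgeOf, dif_pos h', orderEmbOfFin_erase h i h']
      rfl
  · rw [wedgeOf_eq_zero _ h]
    refine Finset.sum_eq_zero fun i hi => ?_
    rw [wedgeOf_eq_zero, mul_zero]
    rw [Finset.card_sdiff_of_subset (by simpa using hi), Finset.card_singleton]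
    have := Finset.card_pos.2 ⟨i, hi⟩
    omega

/-- Vectors of a discrete group with basis `v` wedge to a nonzero integer multiple of the wedge of
`v`. -/
theorem exists_wedgeOf_eq_smul {N m n : ℕ} {v : Fin m → (Fin N → ℝ)} {u : Fin n → (Fin N → ℝ)}
    (hmn : m = n) (hu : LinearIndependent ℝ u)
    (huv : ∀ i, u i ∈ Submodule.span ℤ (range v)) :
    ∃ c : ℝ, 1 ≤ |c| ∧ wedgeOf u = c • wedgeOf v := by
  subst hmn
  choose M hM using fun i => (Submodule.mem_span_range_iff_exists_fun ℤ).1 (huv i)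
  have hmul : u = (Matrix.of M).map (Int.cast : ℤ → ℝ) * Matrix.of v := by
    ext i a
    simp [← hM i, Matrix.mul_apply]
  refine ⟨((Matrix.of M).det : ℤ), ?_, ?_⟩
  · rw [← Int.cast_abs]
    refine mod_cast Int.one_le_abs fun hdet => ?_
    have hdet' : ((Matrix.of M).map (Int.cast : ℤ → ℝ)).det = 0 := by
      have := Int.cast_det (R := ℝ) (Matrix.of M)
      rw [hdet] at this
      simpa using this.symm
    obtain ⟨w, hw, hw0⟩ := Matrix.exists_vecMul_eq_zero_iff.2 hdet'
    refine hw (funext (Fintype.linearIndependent_iff.1 hu w ?_))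
    have : Matrix.vecMul w (Matrix.of u) = ∑ i, w i • u i := by
      ext a
      simp [Matrix.vecMul, dotProduct]
    rw [← this]
    conv_lhs => rw [hmul]
    change Matrix.vecMul w ((Matrix.of M).map (Int.cast : ℤ → ℝ) * Matrix.of v) = 0
    rw [← Matrix.vecMul_vecMul, hw0, Matrix.zero_vecMul]
  · conv_lhs => rw [hmul]
    rw [wedgeOf_matrix_mul, Int.cast_det]
    rfl

theorem discreteTopology_of_le_span {d k : ℕ} {b : Fin k → (Fin d → ℝ)}
    (hb : LinearIndependent ℝ b) {Γ : Submodule ℤ (Fin d → ℝ)}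
    (hΓ : Γ ≤ Submodule.span ℤ (range b)) : DiscreteTopology Γ := by
  let B := Module.Basis.extend hb.linearIndepOn_id
  have hsub : range b ⊆ range B := by
    rw [Module.Basis.range_extend]
    exact hb.linearIndepOn_id.subset_extend _
  have : Finite (hb.linearIndepOn_id.extend (subset_univ _)) := Module.Finite.finite_basis B
  have hB : DiscreteTopology (Submodule.span ℤ (range B)) := inferInstance
  exact DiscreteTopology.of_subset hB (hΓ.trans (Submodule.span_mono hsub))

/-- Every subgroup of a discrete group has a basis that is linearly independent over `ℝ`. -/
theorem exists_represents {d k : ℕ} {b : Fin k → (Fin d → ℝ)}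
    (hb : LinearIndependent ℝ b) {Γ : Submodule ℤ (Fin d → ℝ)}
    (hΓ : Γ ≤ Submodule.span ℤ (range b)) :
    ∃ (j : ℕ) (u : Fin j → (Fin d → ℝ)), Represents u Γ := by
  have hfg : Γ.FG := (Submodule.fg_span (finite_range b)).of_le hΓ
  have : Module.Finite ℤ Γ := Module.Finite.iff_fg.2 hfg
  let B := Module.finBasis ℤ Γ
  have hspan : Submodule.span ℤ (range fun i => (B i : Fin d → ℝ)) = Γ := by
    have : (range fun i => (B i : Fin d → ℝ)) = Γ.subtype '' range B := by
      rw [← range_comp]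
      rfl
    rw [this, ← Submodule.map_span, B.span_eq, Submodule.map_top, Submodule.range_subtype]
  refine ⟨_, fun i => B i, ?_, hspan⟩
  rw [linearIndependent_iff_card_eq_finrank_span, Real.finrank_eq_int_finrank_of_discrete
    (by rw [hspan]; exact discreteTopology_of_le_span hb hΓ)]
  rw [← linearIndependent_iff_card_eq_finrank_span]
  exact B.linearIndependent.map' Γ.subtype (Submodule.ker_subtype Γ)

theorem Represents.span_eq {d j : ℕ} {u : Fin j → (Fin d → ℝ)} {Γ : Submodule ℤ (Fin d → ℝ)}
    (h : Represents u Γ) :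
    Submodule.span ℝ (Γ : Set (Fin d → ℝ)) = Submodule.span ℝ (range u) := by
  rw [← h.2, Submodule.span_span_of_tower]

theorem Represents.finrank_eq {d j : ℕ} {u : Fin j → (Fin d → ℝ)}
    {Γ : Submodule ℤ (Fin d → ℝ)} (h : Represents u Γ) :
    Module.finrank ℝ (Submodule.span ℝ (Γ : Set (Fin d → ℝ))) = j := by
  rw [h.span_eq, finrank_span_eq_card h.1, Fintype.card_fin]

theorem isPrimitiveIn_inf {d : ℕ} (Λ : Submodule ℤ (Fin d → ℝ)) (V : Submodule ℝ (Fin d → ℝ)) :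
    IsPrimitiveIn Λ (V.restrictScalars ℤ ⊓ Λ) := by
  refine ⟨inf_le_right, le_antisymm (inf_le_inf_right _ ?_) (le_inf ?_ inf_le_right)⟩
  · exact Submodule.span_le.2 fun x hx => hx.1
  · exact fun x hx => Submodule.subset_span hx

theorem IsPrimitiveIn.mem_of_mem_span {d : ℕ} {Λ Γ : Submodule ℤ (Fin d → ℝ)}
    (h : IsPrimitiveIn Λ Γ) {x : Fin d → ℝ} (hx : x ∈ Λ)
    (hx' : x ∈ Submodule.span ℝ (Γ : Set (Fin d → ℝ))) : x ∈ Γ := by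
  rw [← h.2]
  exact ⟨hx', hx⟩

/-- A chain of nonzero primitive subgroups of a group of rank `k` has at most `k` elements. -/
theorem card_le_of_isChain {d k : ℕ} {b : Fin k → (Fin d → ℝ)}
    {F : Finset (Submodule ℤ (Fin d → ℝ))}
    (hF : ∀ Γ ∈ F, IsPrimitiveIn (Submodule.span ℤ (range b)) Γ ∧ Γ ≠ ⊥)
    (hchain : IsChain (· ≤ ·) (F : Set (Submodule ℤ (Fin d → ℝ)))) : F.card ≤ k := by
  let rk : Submodule ℤ (Fin d → ℝ) → ℕ := fun Γ =>
    Module.finrank ℝ (Submodule.span ℝ (Γ : Set (Fin d → ℝ)))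
  have key : ∀ Γ ∈ F, ∀ Γ' ∈ F, Γ ≤ Γ' → rk Γ = rk Γ' → Γ = Γ' := by
    intro Γ hΓ Γ' hΓ' hle hrk
    have hspan := Submodule.eq_of_le_of_finrank_eq
      (Submodule.span_mono (R := ℝ) (SetLike.coe_subset_coe.2 hle)) hrk
    refine le_antisymm hle fun x hx => (hF Γ hΓ).1.mem_of_mem_span ((hF Γ' hΓ').1.1 hx) ?_
    rw [hspan]
    exact Submodule.subset_span hx
  have hcard : F.card ≤ (Finset.Icc 1 k).card := by
    refine Finset.card_le_card_of_injOn rk (fun Γ hΓ => ?_) fun Γ hΓ Γ' hΓ' hrk => ?_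
    · obtain ⟨hprim, hne⟩ := hF Γ hΓ
      rw [Finset.coe_Icc, mem_Icc]
      constructor
      · rw [Nat.one_le_iff_ne_zero]
        intro h0
        rw [Submodule.finrank_eq_zero, Submodule.span_eq_bot] at h0
        exact hne ((Submodule.eq_bot_iff _).2 h0)
      · calc rk Γ ≤ Module.finrank ℝ (Submodule.span ℝ (range b)) := by
              refine Submodule.finrank_mono (Submodule.span_le.2 fun x hx => ?_)
              exact Submodule.span_le_restrictScalars ℤ ℝ _ (hprim.1 hx)
          _ ≤ k := (finrank_range_le_card (R := ℝ) b).trans_eq (Fintype.card_fin k)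
    · rcases hchain.total hΓ hΓ' with h | h
      · exact key Γ hΓ Γ' hΓ' h hrk
      · exact (key Γ' hΓ' Γ hΓ h hrk.symm).symm
  simpa using hcard

/-- At a marked point every nonzero lattice vector is long. -/
theorem le_of_isMarked {d k : ℕ} {b : Fin k → (Fin d → ℝ)}
    {ν : (Finset (Fin d) → ℝ) → ℝ} (hν0 : ∀ w, 0 ≤ ν w)
    (hνhom : ∀ (c : ℝ) (w), ν (c • w) = |c| * ν w)
    (hνmul : ∀ u w, ν (wedgeMul u w) ≤ ν u * ν w)
    {ρ ε : ℝ} (hρ : ρ ≤ 1) (hερ : ε ≤ ρ) (M : Matrix (Fin d) (Fin d) ℝ)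
    (j : Submodule ℤ (Fin d → ℝ) → ℕ) (u : ∀ Γ, Fin (j Γ) → (Fin d → ℝ))
    (hu : ∀ Γ, IsPrimitiveIn (Submodule.span ℤ (range b)) Γ → Represents (u Γ) Γ)
    (hM : IsMarked {Γ | IsPrimitiveIn (Submodule.span ℤ (range b)) Γ ∧ Γ ≠ ⊥} ρ ε
      fun Γ => ν (extAction M (wedgeOf (u Γ))))
    {x : Fin d → ℝ} (hx : x ∈ Submodule.span ℤ (range b)) (hx0 : x ≠ 0) :
    ε ≤ ν (extAction M (wedgeOf fun _ : Fin 1 => x)) := by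
  classical
  set Λ := Submodule.span ℤ (range b)
  obtain ⟨F, hFS, hchain, hFν, hmax⟩ := hM
  obtain ⟨Γ₀, n, u₀, hprim, hrep, hxΓ₀, hcomp, hle⟩ : ∃ (Γ₀ : Submodule ℤ (Fin d → ℝ)) (n : ℕ)
      (u₀ : Fin n → (Fin d → ℝ)), IsPrimitiveIn Λ Γ₀ ∧ Represents u₀ Γ₀ ∧ x ∉ Γ₀ ∧
      (∀ Γ ∈ F, Γ ≤ Γ₀ ∨ (Γ₀ ≤ Γ ∧ x ∈ Γ)) ∧
      ν (extAction M (wedgeOf (Fin.cons x u₀ : Fin (n + 1) → (Fin d → ℝ)))) ≤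
        ν (extAction M (wedgeOf fun _ : Fin 1 => x)) := by
    rcases (F.filter (x ∉ ·)).eq_empty_or_nonempty with hF | hF
    · refine ⟨⊥, 0, Fin.elim0, ⟨bot_le, ?_⟩, ⟨linearIndependent_empty_type, by simp⟩,
        by simpa using hx0, fun Γ hΓ => Or.inr ⟨bot_le, ?_⟩, le_of_eq ?_⟩
      · ext y
        simp +contextual
      · by_contra hxΓ
        exact Finset.notMem_empty Γ (hF ▸ Finset.mem_filter.2 ⟨hΓ, hxΓ⟩)
      · congr 3
        funext i
        refine Fin.cases ?_ (fun i => i.elim0) i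
        rfl
    · obtain ⟨Γ₀, hΓ₀⟩ := (F.filter (x ∉ ·)).exists_maximal hF
      obtain ⟨hΓ₀F, hxΓ₀⟩ := Finset.mem_filter.1 hΓ₀.1
      have hprim := (hFS hΓ₀F).1
      refine ⟨Γ₀, j Γ₀, u Γ₀, hprim, hu _ hprim, hxΓ₀, fun Γ hΓ => ?_, ?_⟩
      · by_cases hxΓ : x ∈ Γ
        · exact Or.inr ⟨(hchain.total hΓ hΓ₀F).resolve_left fun h => hxΓ₀ (h hxΓ), hxΓ⟩
        · refine Or.inl ?_
          rcases hchain.total hΓ hΓ₀F with h | h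
          · exact h
          · exact hΓ₀.2 (Finset.mem_filter.2 ⟨hΓ, hxΓ⟩) h
      · have h1 := hνmul (extAction M (wedgeOf fun _ : Fin 1 => x))
          (extAction M (wedgeOf (u Γ₀)))
        have h2 : wedgeMul (extAction M (wedgeOf fun _ : Fin 1 => x))
            (extAction M (wedgeOf (u Γ₀))) =
            extAction M (wedgeOf (Fin.cons x (u Γ₀) : Fin (j Γ₀ + 1) → (Fin d → ℝ))) := by
          rw [extAction_wedgeOf, extAction_wedgeOf, extAction_wedgeOf, wedgeMul_wedgeOf_cons]
          congr 1
          ext i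
          refine Fin.cases ?_ (fun i => ?_) i <;> simp
        rw [h2] at h1
        exact h1.trans (mul_le_of_le_one_right (hν0 _) ((hFν Γ₀ hΓ₀F).2.le.trans hρ))
  set V := Submodule.span ℝ (range (Fin.cons x u₀ : Fin (n + 1) → (Fin d → ℝ))) with hV
  set Δ := V.restrictScalars ℤ ⊓ Λ
  have hΔprim : IsPrimitiveIn Λ Δ := isPrimitiveIn_inf Λ V
  have hind : LinearIndependent ℝ (Fin.cons x u₀ : Fin (n + 1) → (Fin d → ℝ)) := by
    refine linearIndependent_finCons.2 ⟨hrep.1, fun h => hxΓ₀ (hprim.mem_of_mem_span hx ?_)⟩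
    rwa [hrep.span_eq]
  have hu₀ : ∀ i, u₀ i ∈ Γ₀ := fun i => by
    have : u₀ i ∈ Submodule.span ℤ (range u₀) := Submodule.subset_span ⟨i, rfl⟩
    rwa [hrep.2] at this
  have hcons : ∀ i, (Fin.cons x u₀ : Fin (n + 1) → (Fin d → ℝ)) i ∈ Δ := by
    refine fun i => ⟨Submodule.subset_span ⟨i, rfl⟩, ?_⟩
    refine Fin.cases ?_ (fun i => ?_) i
    · exact hx
    · exact hprim.1 (hu₀ i)
  have hxΔ : x ∈ Δ := hcons 0
  have hΓ₀Δ : Γ₀ ≤ Δ := by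
    rw [← hrep.2, Submodule.span_le]
    rintro _ ⟨i, rfl⟩
    exact hcons i.succ
  have hspan : Submodule.span ℝ (Δ : Set (Fin d → ℝ)) = V := by
    refine le_antisymm (Submodule.span_le.2 fun y hy => hy.1) (Submodule.span_le.2 ?_)
    rintro _ ⟨i, rfl⟩
    exact Submodule.subset_span (hcons i)
  have hΔrep := hu Δ hΔprim
  have hrank : j Δ = n + 1 := by
    rw [← hΔrep.finrank_eq, hspan, hV, finrank_span_eq_card hind, Fintype.card_fin]
  obtain ⟨c, hc, hwedge⟩ := exists_wedgeOf_eq_smul hrank hind fun i => by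
    rw [hΔrep.2]
    exact hcons i
  have hΔν : ε ≤ ν (extAction M (wedgeOf (u Δ))) := by
    by_cases hΔF : Δ ∈ F
    · exact (hFν Δ hΔF).1
    · refine hερ.trans (hmax Δ ⟨hΔprim, fun h => hx0 ?_⟩ hΔF fun Γ hΓ => ?_)
      · rw [h] at hxΔ
        exact hxΔ
      · rcases hcomp Γ hΓ with h | ⟨h, hxΓ⟩
        · exact Or.inr (h.trans hΓ₀Δ)
        · refine Or.inl fun y hy => (hFS hΓ).1.mem_of_mem_span hy.2 ?_
          refine Submodule.span_le.2 ?_ hy.1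
          rintro _ ⟨i, rfl⟩
          refine Submodule.subset_span ?_
          refine Fin.cases ?_ (fun i => ?_) i
          · exact hxΓ
          · exact h (hu₀ i)
  refine hΔν.trans (le_trans ?_ hle)
  rw [hwedge, extAction_smul, hνhom]
  exact le_mul_of_one_le_left (hν0 _) hc

/-- Quantitative nondivergence estimate (Bernik–Kleinbock–Margulis, Theorem 6.2).
The discrete subgroup `Λ` of rank `k` is spanned by the `ℝ`-linearly independent
vectors `b 0, …, b (k-1)`; `⋀(W)` is realized in coordinates with respect to the
standard basis, with `wedgeMul` the exterior product and `extAction M` the induced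
action of a matrix `M` on the exterior algebra. -/
theorem quantitative_nondivergence (s : ℕ) (hs : 1 ≤ s) (d k : ℕ) (hk : 1 ≤ k)
    (b : Fin k → (Fin d → ℝ)) (hb : LinearIndependent ℝ b)
    (x₀ : EuclideanSpace ℝ (Fin s)) (r₀ : ℝ) (hr₀ : 0 < r₀)
    (H : EuclideanSpace ℝ (Fin s) → Matrix (Fin d) (Fin d) ℝ)
    (hHcont : ContinuousOn H (ball x₀ (3 ^ k * r₀)))
    (hHinv : ∀ x ∈ ball x₀ (3 ^ k * r₀), IsUnit (H x))
    (C α ρ : ℝ) (hC : 1 ≤ C) (hα : 0 < α) (hρ0 : 0 < ρ) (hρ1 : ρ < 1)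
    (ν : (Finset (Fin d) → ℝ) → ℝ)
    (hν0 : ∀ w, 0 ≤ ν w) (hνcont : Continuous ν)
    (hνhom : ∀ (c : ℝ) (w), ν (c • w) = |c| * ν w)
    (hνmul : ∀ u w, ν (wedgeMul u w) ≤ ν u * ν w)
    (hgood : ∀ j : ℕ, 1 ≤ j → ∀ (u : Fin j → (Fin d → ℝ)) (Γ : Submodule ℤ (Fin d → ℝ)),
      IsPrimitiveIn (Submodule.span ℤ (Set.range b)) Γ → Represents u Γ →
      IsGood s C α (fun x => ν (extAction (H x) (wedgeOf u))) (ball x₀ (3 ^ k * r₀)))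
    (hsup : ∀ j : ℕ, 1 ≤ j → ∀ (u : Fin j → (Fin d → ℝ)) (Γ : Submodule ℤ (Fin d → ℝ)),
      IsPrimitiveIn (Submodule.span ℤ (Set.range b)) Γ → Represents u Γ →
      ∀ η : ℝ, η < ρ → ∃ x ∈ ball x₀ r₀, η < ν (extAction (H x) (wedgeOf u)))
    (hfin : ∀ x ∈ ball x₀ (3 ^ k * r₀),
      {Γ : Submodule ℤ (Fin d → ℝ) |
        IsPrimitiveIn (Submodule.span ℤ (Set.range b)) Γ ∧ Γ ≠ ⊥ ∧
        ∃ (j : ℕ) (u : Fin j → (Fin d → ℝ)), Represents u Γ ∧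
          ν (extAction (H x) (wedgeOf u)) < ρ}.Finite)
    (ε'' : ℝ) (hε : 0 < ε'') :
    volume {x ∈ ball x₀ r₀ | ∃ lam : Fin d → ℝ,
        lam ∈ Submodule.span ℤ (Set.range b) ∧ lam ≠ 0 ∧
        ν (extAction (H x) (wedgeOf fun _ : Fin 1 => lam)) < ε''} ≤
      ENNReal.ofReal ((k : ℝ) * ((3 : ℝ) ^ s * (Nbes s : ℝ)) ^ k * C * (ε'' / ρ) ^ α) *
        volume (ball x₀ r₀) := by
  rcases le_or_gt ε'' ρ with hερ | hερ
  swap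
  · calc volume {x ∈ ball x₀ r₀ | ∃ lam : Fin d → ℝ,
          lam ∈ Submodule.span ℤ (Set.range b) ∧ lam ≠ 0 ∧
          ν (extAction (H x) (wedgeOf fun _ : Fin 1 => lam)) < ε''}
        ≤ 1 * volume (ball x₀ r₀) := by
          rw [one_mul]
          exact measure_mono fun x hx => hx.1
      _ ≤ _ := by
          refine mul_le_mul_left (ENNReal.one_le_ofReal.2 ?_) _
          have h1 : (1 : ℝ) ≤ k := mod_cast hk
          have h2 : 1 ≤ ((3 : ℝ) ^ s * (Nbes s : ℝ)) ^ k :=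
            one_le_pow₀ (one_le_three_pow_mul_Nbes s)
          have h3 : 1 ≤ (ε'' / ρ) ^ α := Real.one_le_rpow ((one_le_div hρ0).2 hερ.le) hα.le
          exact one_le_mul_of_one_le_of_one_le (one_le_mul_of_one_le_of_one_le
            (one_le_mul_of_one_le_of_one_le h1 h2) hC) h3
  set Λ := Submodule.span ℤ (Set.range b)
  have hrep : ∀ Γ : Submodule ℤ (Fin d → ℝ), ∃ (j : ℕ) (u : Fin j → (Fin d → ℝ)),
      IsPrimitiveIn Λ Γ → Represents u Γ := fun Γ => by
    by_cases hΓ : IsPrimitiveIn Λ Γ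
    · obtain ⟨j, u, h⟩ := exists_represents hb hΓ.1
      exact ⟨j, u, fun _ => h⟩
    · exact ⟨0, Fin.elim0, fun h => absurd h hΓ⟩
  choose j u hu using hrep
  have hj : ∀ Γ, IsPrimitiveIn Λ Γ → Γ ≠ ⊥ → 1 ≤ j Γ := fun Γ hΓ hne => by
    rw [Nat.one_le_iff_ne_zero]
    intro h0
    have : IsEmpty (Fin (j Γ)) := by rw [h0]; infer_instance
    apply hne
    rw [← (hu Γ hΓ).2, range_eq_empty, Submodule.span_empty]
  refine (measure_mono ?_).trans (volume_not_isMarked_le hs (zero_le_one.trans hC) hα hρ0 hε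
    (fun Γ x => ν (extAction (H x) (wedgeOf (u Γ)))) (fun _ _ => hν0 _) k
    {Γ | IsPrimitiveIn Λ Γ ∧ Γ ≠ ⊥} x₀ r₀ hr₀ ?_ ?_ ?_ ?_ ?_)
  · rintro x ⟨hx, lam, hlam, hlam0, hlt⟩
    exact ⟨hx, fun hM => hlt.not_ge
      (le_of_isMarked hν0 hνhom hνmul hρ1.le hερ (H x) j u hu hM hlam hlam0)⟩
  · exact fun F hF hchain => card_le_of_isChain (fun Γ hΓ => hF hΓ) hchain
  · exact fun Γ _ => (hνcont.comp (continuous_extAction _)).comp_continuousOn hHcont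
  · exact fun Γ hΓ => hgood (j Γ) (hj Γ hΓ.1 hΓ.2) (u Γ) Γ hΓ.1 (hu Γ hΓ.1)
  · exact fun Γ hΓ => hsup (j Γ) (hj Γ hΓ.1 hΓ.2) (u Γ) Γ hΓ.1 (hu Γ hΓ.1)
  · intro x hx
    refine (hfin x hx).subset ?_
    rintro Γ ⟨⟨hΓ, hne⟩, hlt⟩
    exact ⟨hΓ, hne, j Γ, u Γ, hu Γ hΓ, hlt⟩

end
end

section
/- With the setup in the context, for every t ∈ ℤ_{≥0}, the set A_t := {x ∈ U : ∃ p ∈ ℤ, q ∈ ℤ^n with |p + (x, x̃A)·q| < δ, ‖[Id_s A'] q‖ < K, and 2^t ≤ ‖q‖ < 2^{t+1}} is contained in Ã_t := {x ∈ U : ‖g_t u_x λ‖ < ε for some λ ∈ Λ∖{0}}. -/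
open MeasureTheory Metric Set
open scoped BigOperators ENNReal

noncomputable section

theorem lamVec_eq_append {s m : ℕ} (p : ℤ) (q : Fin (s + m) → ℤ) :
    lamVec s m p q =
      Fin.append (Fin.append (fun _ : Fin 1 => (p : ℝ)) (0 : Fin s → ℝ))
        (fun j => (q j : ℝ)) := by
  funext i
  induction i using Fin.addCases with
  | left i => induction i using Fin.addCases <;> simp [lamVec]
  | right i => simp [lamVec]

theorem uMat_mulVec_lamVec {s m : ℕ} (A : Matrix (Fin (s + 1)) (Fin m) ℝ) (x : Fin s → ℝ)
    (p : ℤ) (q : Fin (s + m) → ℤ) :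
    (uMat A x).mulVec (lamVec s m p q) =
      Fin.append (Fin.append (fun _ : Fin 1 => (p : ℝ) + dotA A x q) (gradA A q))
        (fun j => (q j : ℝ)) := by
  funext i
  rw [Matrix.mulVec, dotProduct, lamVec_eq_append, Fin.sum_univ_add, Fin.sum_univ_add]
  simp only [Fin.append_left, Fin.append_right]
  induction i using Fin.addCases with
  | left i =>
    rw [Fin.sum_univ_add (fun j : Fin (s + m) => _)]
    have hsub (j : ℕ) : 1 + s + (s + j) - (1 + s + s) = j := by omega
    induction i using Fin.addCases with
    | left i =>
      simp [uMat, dotA, phiA, Fin.sum_univ_add, Matrix.vecMul, dotProduct, hsub]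
    | right i =>
      have hdiag (j : Fin s) : 1 + s + (j : ℕ) = 1 + i + s ↔ j = i := by
        rw [Fin.ext_iff]; omega
      have hsucc (h : 1 + (i : ℕ) < s + 1) : (⟨1 + i, h⟩ : Fin (s + 1)) = i.succ :=
        Fin.ext (add_comm 1 (i : ℕ))
      simp [uMat, gradA, hsub, hdiag, hsucc]
  | right i =>
    have h : Fin.castAdd (s + m) (Fin.castAdd s (0 : Fin 1)) ≠ Fin.natAdd (1 + s) i := by
      simp [Fin.ext_iff]; omega
    simp [uMat, add_assoc, h]

/-- `A_t ⊆ Ã_t`: points approximable at scale `t` give short vectors of the lattice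
`g_t u_x Λ` (here `n = s + m`). -/
theorem At_subset_Atilde (s m : ℕ) (hs : 1 ≤ s) (hm : 1 ≤ m)
    (A : Matrix (Fin (s + 1)) (Fin m) ℝ)
    (x₀ : EuclideanSpace ℝ (Fin s)) (r : ℝ) (hr : 0 < r)
    (κ β : ℝ) (hκ0 : 0 < κ) (hκ1 : κ ≤ 1)
    (hβ : β ∈ Ioo (0 : ℝ) (1 / (2 * ((s + m : ℕ) + 1 : ℝ)))) (t : ℕ) :
    {x ∈ ball x₀ r | ∃ (p : ℤ) (q : Fin (s + m) → ℤ),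
        |(p : ℝ) + dotA A (fun i => x i) q| < deltaP s m κ t ∧
        ‖gradA A q‖ < KofT s m r t ∧
        (2 : ℝ) ^ t ≤ ‖q‖ ∧ ‖q‖ < TofT t} ⊆
    {x ∈ ball x₀ r | ∃ (p : ℤ) (q : Fin (s + m) → ℤ), ¬(p = 0 ∧ q = 0) ∧
        ‖(gMat s m (deltaP s m κ t) (KofT s m r t) (TofT t) (epsP s m κ r β t) *
            uMat A (fun i => x i)).mulVec (lamVec s m p q)‖ < epsP s m κ r β t} := by
  rintro x ⟨hx, p, q, hp, hgrad, hqt, hqT⟩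
  have hδ : 0 < deltaP s m κ t := by unfold deltaP; positivity
  have hT : 0 < TofT t := by unfold TofT; positivity
  have hK : 0 < KofT s m r t := (norm_nonneg _).trans_lt hgrad
  have hε : 0 < epsP s m κ r β t := by unfold epsP epsP'; positivity
  refine ⟨hx, p, q, ?_, ?_⟩
  · rintro ⟨-, rfl⟩
    rw [norm_zero] at hqt
    exact absurd hqt (not_le.mpr (by positivity))
  rw [← Matrix.mulVec_mulVec, uMat_mulVec_lamVec, pi_norm_lt_iff hε]
  have key : ∀ {a d : ℝ}, 0 < d → |a| < d →
      ‖epsP s m κ r β t / d * a‖ < epsP s m κ r β t := fun {a d} hd ha => by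
    rw [Real.norm_eq_abs, abs_mul, abs_of_pos (div_pos hε hd), div_mul_eq_mul_div, div_lt_iff₀ hd]
    exact mul_lt_mul_of_pos_left ha hε
  intro i
  rw [gMat, Matrix.mulVec_diagonal]
  induction i using Fin.addCases with
  | left i =>
    induction i using Fin.addCases with
    | left i => simpa using key hδ hp
    | right i => simpa using key hK ((norm_le_pi_norm _ i).trans_lt hgrad)
  | right i =>
    simpa [add_assoc] using key (a := (q i : ℝ)) hT
      (((Int.norm_eq_abs (q i)).symm.le.trans (norm_le_pi_norm q i)).trans_lt hqT)

end
end

section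
/- With the setup in the context, for every 1 ≤ k ≤ n and every w ∈ ⋀^k(ℝ^{n+1}), sup_{x∈U} ‖g̃_t ũ_x w‖ ≥ 2^{−(n+1)/2} · max{ (ε^k/(δ T^{k−1})) · sup_{x∈U} ‖(x, x̃A) c(w)‖, (ε/T)^k ‖π(w)‖ }, where π denotes the orthogonal projection ⋀(ℝ^{n+1}) → ⋀(W_{1→n}). -/
open MeasureTheory Metric Set
open scoped BigOperators ENNReal

noncomputable section

/-- The compound action at `S`, with the cardinality of `S` replaced by an equal number. -/
theorem extAction_eq_of_card {N d : ℕ} (M : Matrix (Fin N) (Fin N) ℝ) (w : Finset (Fin N) → ℝ)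
    (S : Finset (Fin N)) (hS : S.card = d) :
    extAction M w S = ∑ T : Finset (Fin N),
      if h : T.card = d then
        (Matrix.of fun a b : Fin d =>
          M (S.orderEmbOfFin hS a) (T.orderEmbOfFin h b)).det * w T
      else 0 := by
  subst hS
  rfl

theorem extAction_diagonal_mul {N : ℕ} (d : Fin N → ℝ) (M : Matrix (Fin N) (Fin N) ℝ)
    (w : Finset (Fin N) → ℝ) (S : Finset (Fin N)) :
    extAction (Matrix.diagonal d * M) w S = (∏ i ∈ S, d i) * extAction M w S := by
  have hprod : ∏ i ∈ S, d i = ∏ a : Fin S.card, d (S.orderEmbOfFin rfl a) := by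
    conv_lhs => rw [← Finset.image_orderEmbOfFin_univ S rfl]
    rw [Finset.prod_image fun a _ b _ h => (S.orderEmbOfFin rfl).injective h]
  unfold extAction
  rw [Finset.mul_sum]
  refine Finset.sum_congr rfl fun T _ => ?_
  split_ifs with h
  · rw [← mul_assoc, hprod, ← Matrix.det_mul_column]
    simp only [Matrix.diagonal_mul, Matrix.of_apply]
  · simp

theorem extAction_of_zero_notMem {n : ℕ} {M : Matrix (Fin (n + 1)) (Fin (n + 1)) ℝ}
    (hM : ∀ i, i ≠ 0 → ∀ j, M i j = if j = i then 1 else 0)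
    (w : Finset (Fin (n + 1)) → ℝ) {S : Finset (Fin (n + 1))} (hS : 0 ∉ S) :
    extAction M w S = w S := by
  have hne : ∀ a, S.orderEmbOfFin rfl a ≠ 0 := fun a h =>
    hS (h ▸ S.orderEmbOfFin_mem rfl a)
  unfold extAction
  rw [Finset.sum_eq_single S]
  · rw [dif_pos rfl]
    have : (Matrix.of fun a b : Fin S.card =>
        M (S.orderEmbOfFin rfl a) (S.orderEmbOfFin rfl b)) = 1 := by
      ext a b
      simp [hM _ (hne a), Matrix.one_apply, eq_comm]
    rw [this, Matrix.det_one, one_mul]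
  · intro T _ hT
    split_ifs with h
    · obtain ⟨i, hiS, hiT⟩ : ∃ i ∈ S, i ∉ T := by
        by_contra! hsub
        exact hT (Finset.eq_of_subset_of_card_le hsub h.le).symm
      obtain ⟨a, rfl⟩ : i ∈ Set.range (S.orderEmbOfFin rfl) := by simpa using hiS
      rw [Matrix.det_eq_zero_of_row_eq_zero a, zero_mul]
      intro b
      rw [Matrix.of_apply, hM _ (hne a), if_neg]
      exact fun hb => hiT (hb ▸ T.orderEmbOfFin_mem h b)
    · rfl
  · simp

/-- Position of `i` in the increasing enumeration of `insert i J`, and the enumeration of the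
remaining elements. -/
theorem exists_orderEmbOfFin_insert {N d : ℕ} {J : Finset (Fin N)} (hJ : J.card = d) {i : Fin N}
    (h : (insert i J).card = d + 1) :
    ∃ p : Fin (d + 1), (p : ℕ) = (J.filter (· < i)).card ∧
      (insert i J).orderEmbOfFin h p = i ∧
      ∀ b : Fin d, (insert i J).orderEmbOfFin h (p.succAbove b) = J.orderEmbOfFin hJ b := by
  obtain ⟨p, hp⟩ : i ∈ Set.range ((insert i J).orderEmbOfFin h) := by simp
  refine ⟨p, ?_, hp, ?_⟩
  · have hcard : (Finset.Iio p).card = (J.filter (· < i)).card := by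
      refine Finset.card_bij (fun a _ => (insert i J).orderEmbOfFin h a) ?_ ?_ ?_
      · intro a ha
        have hlt : (insert i J).orderEmbOfFin h a < i := by
          conv_rhs => rw [← hp]
          simpa using ha
        have hmem := (insert i J).orderEmbOfFin_mem h a
        rw [Finset.mem_insert] at hmem
        exact Finset.mem_filter.2 ⟨hmem.resolve_left hlt.ne, hlt⟩
      · intro a _ b _ hab
        exact ((insert i J).orderEmbOfFin h).injective hab
      · intro j hj
        obtain ⟨hjJ, hji⟩ := Finset.mem_filter.1 hj
        obtain ⟨a, rfl⟩ : j ∈ Set.range ((insert i J).orderEmbOfFin h) := by simp [hjJ]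
        refine ⟨a, Finset.mem_Iio.2 ?_, rfl⟩
        exact ((insert i J).orderEmbOfFin h).lt_iff_lt.1 (hji.trans_eq hp.symm)
    rw [← hcard, Fin.card_Iio]
  · have := Finset.orderEmbOfFin_unique hJ
      (f := fun b => (insert i J).orderEmbOfFin h (p.succAbove b)) ?_ ?_
    · exact fun b => congrFun this b
    · intro b
      have hmem := (insert i J).orderEmbOfFin_mem h (p.succAbove b)
      rw [Finset.mem_insert] at hmem
      refine hmem.resolve_left fun hb => Fin.succAbove_ne p b ?_
      exact ((insert i J).orderEmbOfFin h).injective (hb.trans hp.symm)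
    · exact ((insert i J).orderEmbOfFin h).strictMono.comp (Fin.strictMono_succAbove p)

theorem det_minor_insert_zero {n d : ℕ} {M : Matrix (Fin (n + 1)) (Fin (n + 1)) ℝ}
    (hM : ∀ i, i ≠ 0 → ∀ j, M i j = if j = i then 1 else 0)
    {J : Finset (Fin (n + 1))} (hJ : J.card = d) (h0 : 0 ∉ J)
    (hS : (insert 0 J).card = d + 1) {i : Fin (n + 1)} (hi : i ∉ J)
    (h : (insert i J).card = d + 1) :
    (Matrix.of fun a b : Fin (d + 1) =>
      M ((insert 0 J).orderEmbOfFin hS a) ((insert i J).orderEmbOfFin h b)).det =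
      (-1) ^ (J.filter (· < i)).card * M 0 i := by
  obtain ⟨q, hq, hq0, hqs⟩ := exists_orderEmbOfFin_insert hJ hS
  obtain ⟨p, hp, hpi, hps⟩ := exists_orderEmbOfFin_insert hJ h
  obtain rfl : q = 0 := by
    ext
    simp [hq]
  simp only [Fin.zero_succAbove] at hqs
  have hne : ∀ a, J.orderEmbOfFin hJ a ≠ 0 := fun a ha => h0 (ha ▸ J.orderEmbOfFin_mem hJ a)
  rw [Matrix.det_succ_column _ p, Fin.sum_univ_succ, Finset.sum_eq_zero, add_zero]
  · have : (Matrix.of fun a b : Fin (d + 1) =>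
        M ((insert 0 J).orderEmbOfFin hS a) ((insert i J).orderEmbOfFin h b)).submatrix
          (Fin.succAbove 0) p.succAbove = 1 := by
      ext a b
      simp only [Matrix.submatrix_apply, Matrix.of_apply, Fin.zero_succAbove, hqs, hps,
        hM _ (hne a), Matrix.one_apply, (J.orderEmbOfFin hJ).injective.eq_iff, eq_comm]
    rw [this, Matrix.det_one, mul_one, Matrix.of_apply, hq0, hpi, ← hp]
    simp
  · intro a _
    rw [Matrix.of_apply, hqs, hpi, hM _ (hne a), if_neg, mul_zero, zero_mul]
    exact fun ha => hi (ha ▸ J.orderEmbOfFin_mem hJ a)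

theorem extAction_insert_zero {n : ℕ} {M : Matrix (Fin (n + 1)) (Fin (n + 1)) ℝ}
    (hM : ∀ i, i ≠ 0 → ∀ j, M i j = if j = i then 1 else 0)
    (w : Finset (Fin (n + 1)) → ℝ) {J : Finset (Fin (n + 1))} (h0 : 0 ∉ J) :
    extAction M w (insert 0 J) = ∑ i, M 0 i * cMap w i J := by
  have hS : (insert 0 J).card = J.card + 1 := Finset.card_insert_of_notMem h0
  rw [extAction_eq_of_card M w _ hS]
  have hinj : Set.InjOn (fun i => insert i J) (Jᶜ : Finset (Fin (n + 1))) := by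
    intro i hi j _ hij
    have hmem : i ∈ insert j J := by
      rw [← show insert i J = insert j J from hij]
      exact Finset.mem_insert_self i J
    exact (Finset.mem_insert.1 hmem).resolve_right (by simpa using hi)
  rw [← Finset.sum_subset (Finset.subset_univ (Jᶜ.image fun i => insert i J)),
    Finset.sum_image hinj, ← Finset.sum_subset (Finset.subset_univ Jᶜ)]
  · refine Finset.sum_congr rfl fun i hi => ?_
    have hi' : i ∉ J := by simpa using hi
    have h : (insert i J).card = J.card + 1 := Finset.card_insert_of_notMem hi'
    rw [dif_pos h, det_minor_insert_zero hM rfl h0 hS hi' h, cMap, if_neg (by tauto)]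
    ring
  · intro i _ hi
    have hi' : i ∈ J := by simpa using hi
    simp [cMap, hi']
  · intro T _ hT
    split_ifs with h
    · obtain ⟨i, hiJ, hiT⟩ : ∃ i ∈ J, i ∉ T := by
        by_contra! hsub
        obtain ⟨i, hi, hins⟩ : ∃ i, i ∉ J ∧ insert i J = T := by
          obtain ⟨i, hi⟩ := Finset.card_eq_one.1
            (show (T \ J).card = 1 by rw [Finset.card_sdiff_of_subset hsub, h]; omega)
          refine ⟨i, ?_, ?_⟩
          · have : i ∈ T \ J := by simp [hi]
            exact (Finset.mem_sdiff.1 this).2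
          · rw [Finset.insert_eq, ← hi, Finset.sdiff_union_of_subset hsub]
        exact hT (Finset.mem_image.2 ⟨i, by simpa using hi, hins⟩)
      obtain ⟨a, ha⟩ : i ∈ Set.range ((insert 0 J).orderEmbOfFin hS) := by simp [hiJ]
      rw [Matrix.det_eq_zero_of_row_eq_zero a, zero_mul]
      intro b
      rw [Matrix.of_apply, ha, hM _ (fun hi => h0 (hi ▸ hiJ)), if_neg]
      exact fun hb => hiT (hb ▸ T.orderEmbOfFin_mem h b)
    · rfl

theorem utMat_of_ne_zero {s m : ℕ} (A : Matrix (Fin (s + 1)) (Fin m) ℝ) (x : Fin s → ℝ)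
    (i : Fin (s + m + 1)) (hi : i ≠ 0) (j : Fin (s + m + 1)) :
    utMat A x i j = if j = i then 1 else 0 :=
  if_neg fun h => hi (Fin.ext h)

theorem utMat_zero {s m : ℕ} (A : Matrix (Fin (s + 1)) (Fin m) ℝ) (x : Fin s → ℝ)
    (j : Fin (s + m + 1)) :
    utMat A x 0 j = (Fin.cons (1 : ℝ) (phiA A x) : Fin (s + m + 1) → ℝ) j := by
  refine Fin.cases ?_ (fun j => ?_) j <;> simp [utMat]

theorem sum_finset_eq_sum_insert_zero {n : ℕ} (f : Finset (Fin (n + 1)) → ℝ) :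
    ∑ S, f S = (∑ J, if (0 : Fin (n + 1)) ∉ J then f (insert 0 J) else 0) +
      ∑ S, if (0 : Fin (n + 1)) ∉ S then f S else 0 := by
  rw [← Finset.sum_filter, ← Finset.sum_filter,
    ← Finset.sum_filter_not_add_sum_filter Finset.univ fun S => (0 : Fin (n + 1)) ∉ S]
  congr 1
  refine Finset.sum_nbij' (fun S => S.erase 0) (fun J => insert 0 J) ?_ ?_ ?_ ?_ ?_ <;>
    simp +contextual [Finset.insert_erase]

/-- Exact formula for the squared norm of `g̃_t ũ_x w`. -/
theorem extNorm_gtMat_mul_utMat_sq {s m : ℕ} (A : Matrix (Fin (s + 1)) (Fin m) ℝ)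
    (x : Fin s → ℝ) (δ T ε : ℝ) {k : ℕ} {w : Finset (Fin (s + m + 1)) → ℝ}
    (hdeg : ExtDeg k w) :
    extNorm (extAction (gtMat s m δ T ε * utMat A x) w) ^ 2 =
      ((ε ^ k / (δ * T ^ (k - 1))) * ycNorm A x w) ^ 2 + ((ε / T) ^ k * piNorm w) ^ 2 := by
  have hpos : ∀ S : Finset (Fin (s + m + 1)), (0 : Fin (s + m + 1)) ∉ S →
      (∏ i ∈ S, if (i : ℕ) = 0 then ε / δ else ε / T) = (ε / T) ^ S.card := by
    intro S hS
    refine Finset.prod_eq_pow_card fun i hi => if_neg fun h => hS ?_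
    rwa [show i = 0 from Fin.ext h] at hi
  have hyc : ycNorm A x w ^ 2 = ∑ J, (∑ i,
      (Fin.cons (1 : ℝ) (phiA A x) : Fin (s + m + 1) → ℝ) i * cMap w i J) ^ 2 :=
    Real.sq_sqrt (Finset.sum_nonneg fun _ _ => sq_nonneg _)
  have hpi : piNorm w ^ 2 = ∑ S : Finset (Fin (s + m + 1)),
      if (0 : Fin (s + m + 1)) ∉ S then (w S) ^ 2 else 0 :=
    Real.sq_sqrt (Finset.sum_nonneg fun _ _ => by split_ifs <;> positivity)
  rw [mul_pow, mul_pow, hyc, hpi, extNorm,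
    Real.sq_sqrt (Finset.sum_nonneg fun _ _ => sq_nonneg _), sum_finset_eq_sum_insert_zero,
    Finset.mul_sum, Finset.mul_sum]
  congr 1
  · refine Finset.sum_congr rfl fun J _ => ?_
    split_ifs with h0
    · simp [cMap, h0]
    · rw [gtMat, extAction_diagonal_mul, extAction_insert_zero (utMat_of_ne_zero A x) w h0,
        Finset.prod_insert h0, hpos J h0, mul_pow]
      simp only [utMat_zero]
      by_cases hJ : J.card + 1 = k
      · subst hJ
        simp only [Fin.val_zero, if_true, Nat.add_sub_cancel]
        congr 2
        rw [div_pow, div_mul_div_comm, pow_succ']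
      · rw [Finset.sum_eq_zero (s := Finset.univ)]
        · simp
        · intro i _
          unfold cMap
          split_ifs with hi
          · simp
          · rw [hdeg, mul_zero, mul_zero]
            rw [Finset.card_insert_of_notMem fun h => hi (Or.inr h)]
            exact hJ
  · refine Finset.sum_congr rfl fun S _ => ?_
    split_ifs with h0
    · simp
    · rw [gtMat, extAction_diagonal_mul, extAction_of_zero_notMem (utMat_of_ne_zero A x) w h0,
        hpos S h0, mul_pow]
      by_cases hS : S.card = k
      · rw [hS]
      · simp [hdeg S hS]

theorem continuous_phiA {s m : ℕ} (A : Matrix (Fin (s + 1)) (Fin m) ℝ) :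
    Continuous fun x : EuclideanSpace ℝ (Fin s) => phiA A (fun i => x i) := by
  refine continuous_pi fun j => ?_
  refine Fin.addCases (fun i => ?_) (fun i => ?_) j
  · simp only [phiA, Fin.append_left]
    fun_prop
  · simp only [phiA, Fin.append_right, Matrix.vecMul, dotProduct, tilde, Fin.sum_univ_succ,
      Fin.cons_zero, Fin.cons_succ]
    fun_prop

theorem continuous_ycNorm {s m : ℕ} (A : Matrix (Fin (s + 1)) (Fin m) ℝ)
    (w : Finset (Fin (s + m + 1)) → ℝ) :
    Continuous fun x : EuclideanSpace ℝ (Fin s) => ycNorm A (fun i => x i) w := by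
  have h := continuous_pi_iff.1 (continuous_phiA A)
  simp only [ycNorm, Fin.sum_univ_succ, Fin.cons_zero, Fin.cons_succ]
  fun_prop

/-- Lower bound for `sup_{x ∈ U} ‖g̃_t ũ_x w‖` in terms of `(x, x̃A) c(w)` and `π(w)`
(equation (4.6) of Kleinbock; here `n = s + m` and `ỹ = (1, x, x̃A)`). -/
theorem sup_lower_bound_cw (s m : ℕ) (hs : 1 ≤ s) (hm : 1 ≤ m)
    (A : Matrix (Fin (s + 1)) (Fin m) ℝ)
    (x₀ : EuclideanSpace ℝ (Fin s)) (r : ℝ) (hr : 0 < r)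
    (δ T ε : ℝ) (hδ : 0 < δ) (hT : 0 < T) (hε : 0 < ε)
    (k : ℕ) (hk1 : 1 ≤ k) (hk2 : k ≤ s + m)
    (w : Finset (Fin (s + m + 1)) → ℝ) (hdeg : ExtDeg k w) :
    (2 : ℝ) ^ (-(((s + m : ℕ) : ℝ) + 1) / 2) *
      max ((ε ^ k / (δ * T ^ (k - 1))) *
          sSup ((fun x : EuclideanSpace ℝ (Fin s) => ycNorm A (fun i => x i) w) '' ball x₀ r))
        ((ε / T) ^ k * piNorm w) ≤
    sSup ((fun x : EuclideanSpace ℝ (Fin s) =>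
      extNorm (extAction (gtMat s m δ T ε * utMat A (fun i => x i)) w)) '' ball x₀ r) := by
  set a := ε ^ k / (δ * T ^ (k - 1))
  set b := (ε / T) ^ k
  set F := fun x : EuclideanSpace ℝ (Fin s) =>
    extNorm (extAction (gtMat s m δ T ε * utMat A (fun i => x i)) w)
  have ha0 : 0 < a := by positivity
  have hF0 : ∀ x, 0 ≤ F x := fun x => Real.sqrt_nonneg _
  have hsq : ∀ x, F x ^ 2 = (a * ycNorm A (fun i => x i) w) ^ 2 + (b * piNorm w) ^ 2 :=
    fun x => extNorm_gtMat_mul_utMat_sq A (fun i => x i) δ T ε hdeg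
  have hcont : Continuous F := by
    have hsqrt : F = fun x : EuclideanSpace ℝ (Fin s) =>
        Real.sqrt ((a * ycNorm A (fun i => x i) w) ^ 2 + (b * piNorm w) ^ 2) := by
      ext x
      rw [← hsq, Real.sqrt_sq (hF0 x)]
    rw [hsqrt]
    have := continuous_ycNorm A w
    fun_prop
  have hbdd : BddAbove (F '' ball x₀ r) :=
    ((isCompact_closedBall x₀ r).bddAbove_image hcont.continuousOn).mono
      (image_mono ball_subset_closedBall)
  have hle : ∀ x ∈ ball x₀ r, F x ≤ sSup (F '' ball x₀ r) := fun x hx =>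
    le_csSup hbdd (mem_image_of_mem F hx)
  have hx₀ : x₀ ∈ ball x₀ r := mem_ball_self hr
  have hmax : max (a * sSup ((fun x : EuclideanSpace ℝ (Fin s) =>
      ycNorm A (fun i => x i) w) '' ball x₀ r)) (b * piNorm w) ≤ sSup (F '' ball x₀ r) := by
    refine max_le ?_ ?_
    · rw [← le_div_iff₀' ha0]
      refine csSup_le ⟨_, mem_image_of_mem _ hx₀⟩ ?_
      rintro _ ⟨x, hx, rfl⟩
      rw [le_div_iff₀' ha0]
      refine le_trans (abs_le_of_sq_le_sq' ?_ (hF0 x)).2 (hle x hx)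
      rw [hsq]
      exact le_add_of_nonneg_right (sq_nonneg _)
    · refine le_trans (abs_le_of_sq_le_sq' ?_ (hF0 x₀)).2 (hle x₀ hx₀)
      rw [hsq]
      exact le_add_of_nonneg_left (sq_nonneg _)
  have hconst : (2 : ℝ) ^ (-(((s + m : ℕ) : ℝ) + 1) / 2) ≤ 1 := by
    refine Real.rpow_le_one_of_one_le_of_nonpos one_le_two ?_
    have : (0 : ℝ) ≤ ((s + m : ℕ) : ℝ) := Nat.cast_nonneg _
    linarith
  refine le_trans (mul_le_of_le_one_left (le_max_of_le_right ?_) hconst) hmax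
  exact mul_nonneg (by positivity) (Real.sqrt_nonneg _)

end
end

section
/- Let 1 ≤ s < n and A ∈ Mat_{(s+1)×(n−s)}(ℝ). Then for every k with n−s < k ≤ n, for all but finitely many w ∈ ⋀^k(ℤ^{n+1}) one has ‖R_A c(w)‖ ≥ 1. -/
open MeasureTheory Metric Set
open scoped BigOperators ENNReal

noncomputable section

lemma abs_RAc_le_RAcNorm {s m : ℕ} (A : Matrix (Fin (s + 1)) (Fin m) ℝ)
    (w : Finset (Fin (s + m + 1)) → ℝ) (a : Fin (s + 1)) (J : Finset (Fin (s + m + 1))) :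
    |RAc A w a J| ≤ RAcNorm A w := by
  refine Real.abs_le_sqrt ?_
  calc RAc A w a J ^ 2 ≤ ∑ J, RAc A w a J ^ 2 :=
        Finset.single_le_sum (f := fun J => RAc A w a J ^ 2)
          (fun _ _ => sq_nonneg _) (Finset.mem_univ J)
    _ ≤ ∑ a, ∑ J, RAc A w a J ^ 2 :=
        Finset.single_le_sum (f := fun a => ∑ J, RAc A w a J ^ 2)
          (fun _ _ => Finset.sum_nonneg fun _ _ => sq_nonneg _) (Finset.mem_univ a)

lemma cMap_of_mem {n : ℕ} (w : Finset (Fin (n + 1)) → ℝ) {i : Fin (n + 1)}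
    {J : Finset (Fin (n + 1))} (hi : i ∈ J) : cMap w i J = 0 := by
  simp [cMap, hi]

lemma abs_cMap_eq {n : ℕ} (w : Finset (Fin (n + 1)) → ℝ) {i : Fin (n + 1)}
    {J : Finset (Fin (n + 1))} (h0 : 0 ∉ J) (hi : i ∉ J) :
    |cMap w i J| = |w (insert i J)| := by
  simp [cMap, h0, hi, abs_mul]

/-- A set of more than `m` indices in `{0, …, s + m}` contains an index at most `s`. -/
lemma exists_mem_le_of_lt_card {s m : ℕ} (S : Finset (Fin (s + m + 1))) (h : m < S.card) :
    ∃ i ∈ S, (i : ℕ) ≤ s := by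
  by_contra! hS
  have hcard : (S.image fun i : Fin (s + m + 1) => (i : ℕ)).card ≤
      (Finset.Ioc s (s + m)).card := by
    refine Finset.card_le_card fun j hj => ?_
    obtain ⟨i, hi, rfl⟩ := Finset.mem_image.mp hj
    have := hS i hi
    exact Finset.mem_Ioc.mpr ⟨this, by omega⟩
  rw [Finset.card_image_of_injective _ Fin.val_injective, Nat.card_Ioc] at hcard
  omega

/-- In degree `k > m`, the coordinates of `w` are bounded in terms of those of `R_A c(w)`,
by induction on the number of indices at most `s`. -/
lemma exists_abs_le_of_abs_RAc_le {s m : ℕ} (A : Matrix (Fin (s + 1)) (Fin m) ℝ)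
    (k : ℕ) (hk : m < k) (ℓ : ℕ) :
    ∃ C : ℝ, 0 ≤ C ∧ ∀ w : Finset (Fin (s + m + 1)) → ℝ, (∀ a J, |RAc A w a J| ≤ 1) →
      ∀ S : Finset (Fin (s + m + 1)), S.card = k →
        (S.filter fun i : Fin (s + m + 1) => (i : ℕ) ≤ s).card ≤ ℓ → |w S| ≤ C := by
  induction ℓ with
  | zero =>
    refine ⟨0, le_rfl, fun w _ S hS h => ?_⟩
    obtain ⟨i, hi, his⟩ := exists_mem_le_of_lt_card S (hS ▸ hk)
    have hpos : 0 < (S.filter fun i : Fin (s + m + 1) => (i : ℕ) ≤ s).card :=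
      Finset.card_pos.mpr ⟨i, Finset.mem_filter.mpr ⟨hi, his⟩⟩
    omega
  | succ ℓ ih =>
    obtain ⟨C, hC, ih⟩ := ih
    refine ⟨1 + ∑ a, ∑ i, |RA A a i| * C, by positivity, fun w hw S hS h => ?_⟩
    obtain ⟨i, hi, his⟩ := exists_mem_le_of_lt_card S (hS ▸ hk)
    have hne : S.Nonempty := ⟨i, hi⟩
    set b := S.min' hne
    have hbS : b ∈ S := S.min'_mem hne
    have hbs : (b : ℕ) ≤ s := le_trans (Fin.le_def.mp (S.min'_le i hi)) his
    set J := S.erase b with hJ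
    have hbJ : b ∉ J := Finset.notMem_erase b S
    have h0J : (0 : Fin (s + m + 1)) ∉ J := fun h0 => by
      have hb0 : b ≤ 0 := S.min'_le 0 (Finset.mem_of_mem_erase h0)
      exact Finset.ne_of_mem_erase h0 (le_antisymm (Fin.zero_le b) hb0)
    have hins : insert b J = S := Finset.insert_erase hbS
    let a : Fin (s + 1) := ⟨b, by omega⟩
    have hterm : ∀ i ∈ Finset.univ.erase b, |RA A a i * cMap w i J| ≤ |RA A a i| * C := by
      intro i hib
      have hib := Finset.ne_of_mem_erase hib
      rw [abs_mul]
      by_cases his : (i : ℕ) < s + 1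
      · have : RA A a i = 0 := by
          simp [RA, his, a, Fin.val_inj, hib]
        simp [this]
      refine mul_le_mul_of_nonneg_left ?_ (abs_nonneg _)
      by_cases hiJ : i ∈ J
      · simpa [cMap_of_mem w hiJ] using hC
      rw [abs_cMap_eq w h0J hiJ]
      refine ih w hw _ ?_ ?_
      · rw [Finset.card_insert_of_notMem hiJ, hJ, Finset.card_erase_add_one hbS, hS]
      · rw [Finset.filter_insert, if_neg (by omega), hJ, Finset.filter_erase,
          Finset.card_erase_of_mem (Finset.mem_filter.mpr ⟨hbS, hbs⟩)]
        omega
    have hRb : RA A a b = 1 := by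
      simp [RA, a, Nat.lt_succ_of_le hbs]
    have hsum : RAc A w a J = cMap w b J + ∑ i ∈ Finset.univ.erase b, RA A a i * cMap w i J := by
      rw [RAc, ← Finset.add_sum_erase _ _ (Finset.mem_univ b), hRb, one_mul]
    calc |w S| = |cMap w b J| := by rw [abs_cMap_eq w h0J hbJ, hins]
      _ = |RAc A w a J - ∑ i ∈ Finset.univ.erase b, RA A a i * cMap w i J| := by
        rw [hsum, add_sub_cancel_right]
      _ ≤ |RAc A w a J| + |∑ i ∈ Finset.univ.erase b, RA A a i * cMap w i J| := abs_sub _ _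
      _ ≤ 1 + ∑ i ∈ Finset.univ.erase b, |RA A a i| * C :=
        add_le_add (hw a J)
          ((Finset.abs_sum_le_sum_abs _ _).trans (Finset.sum_le_sum hterm))
      _ ≤ 1 + ∑ i, |RA A a i| * C := by
        gcongr
        exact Finset.erase_subset _ _
      _ ≤ 1 + ∑ a, ∑ i, |RA A a i| * C := by
        gcongr
        exact Finset.single_le_sum (f := fun a => ∑ i, |RA A a i| * C)
          (fun _ _ => by positivity) (Finset.mem_univ a)

/-- For every `n - s < k ≤ n`, all but finitely many `w ∈ ⋀^k(ℤ^{n+1})` satisfy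
`‖R_A c(w)‖ ≥ 1` (here `n = s + m`, so `n - s = m`). -/
theorem RAc_ge_one_cofinite (s m : ℕ) (hs : 1 ≤ s) (hm : 1 ≤ m)
    (A : Matrix (Fin (s + 1)) (Fin m) ℝ)
    (k : ℕ) (hk1 : m < k) (hk2 : k ≤ s + m) :
    {w : Finset (Fin (s + m + 1)) → ℤ |
      (∀ S, S.card ≠ k → w S = 0) ∧
      RAcNorm A (fun S => (w S : ℝ)) < 1}.Finite := by
  obtain ⟨C, hC, hbound⟩ := exists_abs_le_of_abs_RAc_le A k hk1 (s + m + 1)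
  refine (Set.Finite.pi' fun _ => Set.finite_Icc (-⌈C⌉) ⌈C⌉).subset ?_
  rintro w ⟨hdeg, hw⟩ S
  rw [Set.mem_Icc, ← abs_le]
  by_cases hS : S.card = k
  · have h := hbound (fun S => (w S : ℝ))
      (fun a J => (abs_RAc_le_RAcNorm A _ a J).trans hw.le) S hS
      ((Finset.card_le_univ _).trans_eq (Fintype.card_fin _))
    exact_mod_cast h.trans (Int.le_ceil C)
  · simpa [hdeg S hS] using Int.ceil_nonneg hC

end
end
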